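/- arXiv:math/0703644 — 3 statements merged into one kernel-verified Lean document; each statement's English description precedes it below -/
import Mathlib

section
/- (a) If W is an injective cogenerator for X and X is closed under extensions, then G^n(X) ⊆ cores~(W) for each n ≥ 0, i.e. every object of G^n(X) admits a proper W-coresolution. (b) Dually, if V is a projective generator for Y and Y is closed under extensions, then G^n(Y) ⊆ res~(V) for each n ≥ 0. -/
open CategoryTheory CategoryTheory.Limits CategoryTheory.Abelian

universe w v u

variable {C : Type u} [Category.{v} C] [Abelian C]

/-- A class of objects is closed under isomorphisms. -/
def IsoClosed (𝒲 : Set C) : Prop :=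
  ∀ ⦃A B : C⦄, (A ≅ B) → A ∈ 𝒲 → B ∈ 𝒲

/-- A class of objects is closed under finite direct sums (part of being an
additive subcategory). -/
def SumClosed (𝒲 : Set C) : Prop :=
  ∀ ⦃A B : C⦄, A ∈ 𝒲 → B ∈ 𝒲 → (A ⊞ B) ∈ 𝒲

/-- A class of objects is closed under extensions. -/
def ExtensionClosed (𝒲 : Set C) : Prop :=
  ∀ ⦃A₁ A₂ A₃ : C⦄ (f : A₁ ⟶ A₂) (g : A₂ ⟶ A₃) (w : f ≫ g = 0),
    (ShortComplex.mk f g w).ShortExact → A₁ ∈ 𝒲 → A₃ ∈ 𝒲 → A₂ ∈ 𝒲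

/-- A class of objects is closed under kernels of epimorphisms. -/
def KerEpiClosed (𝒲 : Set C) : Prop :=
  ∀ ⦃A₁ A₂ A₃ : C⦄ (f : A₁ ⟶ A₂) (g : A₂ ⟶ A₃) (w : f ≫ g = 0),
    (ShortComplex.mk f g w).ShortExact → A₂ ∈ 𝒲 → A₃ ∈ 𝒲 → A₁ ∈ 𝒲

/-- A class of objects is closed under cokernels of monomorphisms. -/
def CokerMonoClosed (𝒲 : Set C) : Prop :=
  ∀ ⦃A₁ A₂ A₃ : C⦄ (f : A₁ ⟶ A₂) (g : A₂ ⟶ A₃) (w : f ≫ g = 0),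
    (ShortComplex.mk f g w).ShortExact → A₁ ∈ 𝒲 → A₂ ∈ 𝒲 → A₃ ∈ 𝒲

section ExtDefs

variable [HasExt.{w} C]

/-- `X ⊥ Y`, i.e. `Ext^i(X, Y) = 0` for all `i ≥ 1`. -/
def extPerp (X Y : C) : Prop :=
  ∀ i : ℕ, 1 ≤ i → Subsingleton (Abelian.Ext X Y i)

end ExtDefs

/-- `𝒲` is a cogenerator for `𝒳`: `𝒲 ⊆ 𝒳` and every object of `𝒳` embeds in an
object of `𝒲` with cokernel in `𝒳`. -/
def IsCogen (𝒲 𝒳 : Set C) : Prop :=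
  𝒲 ⊆ 𝒳 ∧ ∀ X ∈ 𝒳, ∃ (W X' : C) (i : X ⟶ W) (p : W ⟶ X') (w : i ≫ p = 0),
    W ∈ 𝒲 ∧ X' ∈ 𝒳 ∧ (ShortComplex.mk i p w).ShortExact

/-- `𝒱` is a generator for `𝒴`: `𝒱 ⊆ 𝒴` and every object of `𝒴` is a quotient of an
object of `𝒱` with kernel in `𝒴`. -/
def IsGen (𝒱 𝒴 : Set C) : Prop :=
  𝒱 ⊆ 𝒴 ∧ ∀ Y ∈ 𝒴, ∃ (Y' V : C) (i : Y' ⟶ V) (p : V ⟶ Y) (w : i ≫ p = 0),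
    V ∈ 𝒱 ∧ Y' ∈ 𝒴 ∧ (ShortComplex.mk i p w).ShortExact

section ExtDefs2

variable [HasExt.{w} C]

/-- `𝒲` is an injective cogenerator for `𝒳`. -/
def IsInjCogen (𝒲 𝒳 : Set C) : Prop :=
  IsCogen 𝒲 𝒳 ∧ ∀ X ∈ 𝒳, ∀ W ∈ 𝒲, extPerp X W

/-- `𝒱` is a projective generator for `𝒴`. -/
def IsProjGen (𝒱 𝒴 : Set C) : Prop :=
  IsGen 𝒱 𝒴 ∧ ∀ V ∈ 𝒱, ∀ Y ∈ 𝒴, extPerp V Y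

end ExtDefs2

/-- The data `(P, d, ε)` is a resolution of `M`: the augmented complex
`⋯ → P₁ → P₀ → M → 0` is exact. -/
structure IsResolution (P : ℕ → C) (d : ∀ n, P (n + 1) ⟶ P n) (M : C) (ε : P 0 ⟶ M) :
    Prop where
  w0 : d 0 ≫ ε = 0
  w : ∀ n, d (n + 1) ≫ d n = 0
  epi : Epi ε
  exact0 : (ShortComplex.mk (d 0) ε w0).Exact
  exact : ∀ n, (ShortComplex.mk (d (n + 1)) (d n) (w n)).Exact

/-- The data `(Q, δ, η)` is a coresolution of `M`: the augmented complex
`0 → M → Q⁰ → Q¹ → ⋯` is exact. -/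
structure IsCoresolution (Q : ℕ → C) (δ : ∀ n, Q n ⟶ Q (n + 1)) (M : C) (η : M ⟶ Q 0) :
    Prop where
  w0 : η ≫ δ 0 = 0
  w : ∀ n, δ n ≫ δ (n + 1) = 0
  mono : Mono η
  exact0 : (ShortComplex.mk η (δ 0) w0).Exact
  exact : ∀ n, (ShortComplex.mk (δ n) (δ (n + 1)) (w n)).Exact

/-- `Hom(W', -)` applied to the augmented complex `⋯ → P₁ → P₀ → M → 0` is exact for
every `W'` in `𝒳` (properness of the resolution). -/
def ResHomExact (𝒳 : Set C) (P : ℕ → C) (d : ∀ n, P (n + 1) ⟶ P n) {M : C}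
    (ε : P 0 ⟶ M) : Prop :=
  ∀ W ∈ 𝒳,
    (∀ φ : W ⟶ M, ∃ ψ : W ⟶ P 0, ψ ≫ ε = φ) ∧
    (∀ φ : W ⟶ P 0, φ ≫ ε = 0 → ∃ ψ : W ⟶ P 1, ψ ≫ d 0 = φ) ∧
    (∀ (n : ℕ) (φ : W ⟶ P (n + 1)), φ ≫ d n = 0 → ∃ ψ : W ⟶ P (n + 2), ψ ≫ d (n + 1) = φ)

/-- `Hom(-, W')` applied to the augmented complex `0 → M → Q⁰ → Q¹ → ⋯` is exact for
every `W'` in `𝒲` (properness of the coresolution). -/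
def CoresHomExact (𝒲 : Set C) (Q : ℕ → C) (δ : ∀ n, Q n ⟶ Q (n + 1)) {M : C}
    (η : M ⟶ Q 0) : Prop :=
  ∀ W ∈ 𝒲,
    (∀ φ : M ⟶ W, ∃ ψ : Q 0 ⟶ W, η ≫ ψ = φ) ∧
    (∀ φ : Q 0 ⟶ W, η ≫ φ = 0 → ∃ ψ : Q 1 ⟶ W, δ 0 ≫ ψ = φ) ∧
    (∀ (n : ℕ) (φ : Q (n + 1) ⟶ W), δ n ≫ φ = 0 → ∃ ψ : Q (n + 2) ⟶ W, δ (n + 1) ≫ ψ = φ)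

/-- `M` admits a proper `𝒳`-resolution, i.e. `M ∈ res~(𝒳)`. -/
def MemProperRes (𝒳 : Set C) (M : C) : Prop :=
  ∃ (P : ℕ → C) (d : ∀ n, P (n + 1) ⟶ P n) (ε : P 0 ⟶ M),
    (∀ n, P n ∈ 𝒳) ∧ IsResolution P d M ε ∧ ResHomExact 𝒳 P d ε

/-- `M` admits a proper `𝒲`-coresolution, i.e. `M ∈ cores~(𝒲)`. -/
def MemProperCores (𝒲 : Set C) (M : C) : Prop :=
  ∃ (Q : ℕ → C) (δ : ∀ n, Q n ⟶ Q (n + 1)) (η : M ⟶ Q 0),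
    (∀ n, Q n ∈ 𝒲) ∧ IsCoresolution Q δ M η ∧ CoresHomExact 𝒲 Q δ η

/-- `M` has finite `𝒴`-projective dimension: it admits a resolution
`0 → Y_n → ⋯ → Y_0 → M → 0` with all `Y_i` in `𝒴`, i.e. `M ∈ res^f(𝒴)`. -/
def FinResDim (𝒴 : Set C) (M : C) : Prop :=
  ∃ (n : ℕ) (P : ℕ → C) (d : ∀ k, P (k + 1) ⟶ P k) (ε : P 0 ⟶ M),
    (∀ k ≤ n, P k ∈ 𝒴) ∧ (∀ k, n < k → IsZero (P k)) ∧ IsResolution P d M ε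

/-- `M` has finite `𝒳`-injective dimension: it admits a coresolution
`0 → M → X^0 → ⋯ → X^n → 0` with all `X^i` in `𝒳`, i.e. `M ∈ cores^f(𝒳)`. -/
def FinCoresDim (𝒳 : Set C) (M : C) : Prop :=
  ∃ (n : ℕ) (Q : ℕ → C) (δ : ∀ k, Q k ⟶ Q (k + 1)) (η : M ⟶ Q 0),
    (∀ k ≤ n, Q k ∈ 𝒳) ∧ (∀ k, n < k → IsZero (Q k)) ∧ IsCoresolution Q δ M η

/-- The `ℤ`-indexed complex `(X, d)` is totally `𝒳`-acyclic: all terms lie in `𝒳`,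
it is exact, and `Hom(W, -)` and `Hom(-, W)` applied to it are exact for all `W ∈ 𝒳`. -/
structure IsTotallyAcyclic (𝒳 : Set C) (X : ℤ → C) (d : ∀ n : ℤ, X (n + 1) ⟶ X n) :
    Prop where
  mem : ∀ n, X n ∈ 𝒳
  w : ∀ n, d (n + 1) ≫ d n = 0
  exact : ∀ n, (ShortComplex.mk (d (n + 1)) (d n) (w n)).Exact
  homExact : ∀ W ∈ 𝒳, ∀ (n : ℤ) (φ : W ⟶ X (n + 1)), φ ≫ d n = 0 →
    ∃ ψ : W ⟶ X (n + 1 + 1), ψ ≫ d (n + 1) = φ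
  homExact' : ∀ W ∈ 𝒳, ∀ (n : ℤ) (φ : X (n + 1) ⟶ W), d (n + 1) ≫ φ = 0 →
    ∃ ψ : X n ⟶ W, d n ≫ ψ = φ

/-- The Gorenstein subcategory `G(𝒳)`: objects isomorphic to `Coker(∂₁)` of a totally
`𝒳`-acyclic complex. -/
def GorClass (𝒳 : Set C) : Set C :=
  {M | ∃ (X : ℤ → C) (d : ∀ n : ℤ, X (n + 1) ⟶ X n),
    IsTotallyAcyclic 𝒳 X d ∧ Nonempty (cokernel (d 0) ≅ M)}

/-- Iterated Gorenstein subcategories: `G^0(𝒳) = 𝒳`, `G^{n+1}(𝒳) = G(G^n(𝒳))`. -/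
def GorIter (𝒳 : Set C) : ℕ → Set C
  | 0 => 𝒳
  | n + 1 => GorClass (GorIter 𝒳 n)

/-- The upper triangular matrix morphism `[[a, b], [0, c]]` between biproducts. -/
noncomputable def triMat {P' P'' Q' Q'' : C} (a : P' ⟶ Q') (b : P'' ⟶ Q') (c : P'' ⟶ Q'') :
    P' ⊞ P'' ⟶ Q' ⊞ Q'' :=
  biprod.lift (biprod.fst ≫ a + biprod.snd ≫ b) (biprod.snd ≫ c)

/-- Short exactness of a composable pair. -/
structure SE {D : Type*} [Category D] [Abelian D] {A B E : D} (f : A ⟶ B) (g : B ⟶ E) : Prop where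
  w : f ≫ g = 0
  ex : (ShortComplex.mk f g w).ShortExact

namespace SE

section

variable {D : Type*} [Category D] [Abelian D]

theorem mono {A B E : D} {f : A ⟶ B} {g : B ⟶ E} (h : SE f g) : Mono f := h.ex.mono_f

theorem epi {A B E : D} {f : A ⟶ B} {g : B ⟶ E} (h : SE f g) : Epi g := h.ex.epi_g

theorem lift {A B E : D} {f : A ⟶ B} {g : B ⟶ E} (h : SE f g) {T : D} (x : T ⟶ B)
    (hx : x ≫ g = 0) : ∃ y : T ⟶ A, y ≫ f = x := by
  have := h.mono
  have : Mono (ShortComplex.mk f g h.w).f := this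
  exact ⟨h.ex.exact.lift x hx, h.ex.exact.lift_f x hx⟩

theorem desc {A B E : D} {f : A ⟶ B} {g : B ⟶ E} (h : SE f g) {T : D} (x : B ⟶ T)
    (hx : f ≫ x = 0) : ∃ y : E ⟶ T, g ≫ y = x := by
  have : Epi (ShortComplex.mk f g h.w).g := h.epi
  exact ⟨h.ex.exact.desc x hx, h.ex.exact.g_desc x hx⟩

theorem surj {A B E : D} {f : A ⟶ B} {g : B ⟶ E} (h : SE f g) {T : D} (x : T ⟶ E) :
    ∃ (T' : D) (π : T' ⟶ T) (_ : Epi π) (y : T' ⟶ B), π ≫ x = y ≫ g := by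
  have := h.epi
  exact surjective_up_to_refinements_of_epi g x

theorem of {A B E : D} {f : A ⟶ B} {g : B ⟶ E} (w : f ≫ g = 0)
    (hm : ∀ (T : D) (x : T ⟶ A), x ≫ f = 0 → x = 0)
    (hx : ∀ (T : D) (x : T ⟶ B), x ≫ g = 0 →
      ∃ (T' : D) (π : T' ⟶ T) (_ : Epi π) (y : T' ⟶ A), π ≫ x = y ≫ f)
    (he : Epi g) : SE f g := by
  refine ⟨w, ?_⟩
  have : Mono f := Preadditive.mono_of_cancel_zero _ (fun {T} x h => hm T x h)
  exact { exact := by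
            rw [ShortComplex.exact_iff_exact_up_to_refinements]
            intro T x h
            exact hx T x h
          mono_f := this
          epi_g := he }

theorem coker {A B : D} (f : A ⟶ B) [Mono f] : SE f (cokernel.π f) :=
  ⟨by simp, { exact := ShortComplex.exact_of_g_is_cokernel _ (cokernelIsCokernel f)
              mono_f := by assumption
              epi_g := by dsimp; infer_instance }⟩

theorem op' {A B E : D} {f : A ⟶ B} {g : B ⟶ E} (h : SE f g) : SE g.op f.op :=
  ⟨by rw [← op_comp, h.w]; rfl, h.ex.op⟩

theorem unop' {A B E : Dᵒᵖ} {f : A ⟶ B} {g : B ⟶ E} (h : SE f g) : SE g.unop f.unop :=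
  ⟨by rw [← unop_comp, h.w]; rfl, h.ex.unop⟩

/-- Composite embedding. -/
theorem comp {N P N' W P' : D} {f : N ⟶ P} {g : P ⟶ N'} {i : P ⟶ W} {p : W ⟶ P'}
    (h : SE f g) (k : SE i p) :
    ∃ (U : D) (q : W ⟶ U) (a : N' ⟶ U) (c : U ⟶ P'), SE (f ≫ i) q ∧ SE a c := by
  have := h.mono
  have := k.mono
  have := k.epi
  have hq := coker (f ≫ i)
  set q := cokernel.π (f ≫ i)
  obtain ⟨a, ha⟩ := h.desc (i ≫ q) (by rw [← Category.assoc, hq.w])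
  obtain ⟨c, hc⟩ := hq.desc p (by rw [Category.assoc, k.w, comp_zero])
  refine ⟨_, q, a, c, hq, of ?_ ?_ ?_ ?_⟩
  · have := h.epi
    rw [← cancel_epi g, reassoc_of% ha, hc, k.w, comp_zero]
  · intro T x hx
    obtain ⟨T', π, _, y, hy⟩ := h.surj x
    obtain ⟨z, hz⟩ := hq.lift (y ≫ i) (by
      rw [Category.assoc, ← ha, ← reassoc_of% hy, hx, comp_zero])
    have : y = z ≫ f := by rw [← cancel_mono i, ← hz, Category.assoc]
    rw [← cancel_epi π, hy, this, Category.assoc, h.w, comp_zero, comp_zero]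
  · intro T x hx
    obtain ⟨T', π, e, v, hv⟩ := hq.surj x
    obtain ⟨y, hy⟩ := k.lift v (by rw [← hc, ← reassoc_of% hv, hx, comp_zero])
    exact ⟨T', π, e, y ≫ g, by rw [hv, Category.assoc, ha, ← hy, Category.assoc]⟩
  · exact epi_of_epi_fac hc

/-- Horseshoe. -/
theorem horseshoe {A B E WA WE A' E' : D} {i : A ⟶ B} {q : B ⟶ E} {a : A ⟶ WA} {a' : WA ⟶ A'}
    {c : E ⟶ WE} {c' : WE ⟶ E'} (h : SE i q) (hA : SE a a') (hE : SE c c')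
    (t : B ⟶ WA) (ht : i ≫ t = a) :
    ∃ (B' : D) (b : B ⟶ WA ⊞ WE) (b' : WA ⊞ WE ⟶ B') (j : A' ⟶ B') (r : B' ⟶ E'),
      SE b b' ∧ SE j r := by
  have := hA.mono
  have := hE.mono
  have := hE.epi
  have := hA.epi
  let b : B ⟶ WA ⊞ WE := biprod.lift t (q ≫ c)
  have b1 : b ≫ biprod.fst = t := by simp [b]
  have b2 : b ≫ biprod.snd = q ≫ c := by simp [b]
  have hbm : Mono b := by
    refine Preadditive.mono_of_cancel_zero _ (fun {T} x hx => ?_)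
    have h1 : x ≫ t = 0 := by rw [← b1, reassoc_of% hx, zero_comp]
    have h2 : x ≫ q = 0 := by
      rw [← cancel_mono c, Category.assoc, ← b2, reassoc_of% hx, zero_comp, zero_comp]
    obtain ⟨y, rfl⟩ := h.lift x h2
    rw [Category.assoc, ht] at h1
    rw [(cancel_mono a).1 (h1.trans zero_comp.symm), zero_comp]
  have hb := coker b
  set b' := cokernel.π b
  have ib : i ≫ b = a ≫ biprod.inl := by
    apply biprod.hom_ext
    · rw [Category.assoc, b1, ht]; simp
    · rw [Category.assoc, b2, reassoc_of% h.w]; simp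
  obtain ⟨j, hj⟩ := hA.desc (biprod.inl ≫ b') (by
    rw [← Category.assoc, ← ib, Category.assoc, hb.w, comp_zero])
  obtain ⟨r, hr⟩ := hb.desc (biprod.snd ≫ c') (by
    rw [reassoc_of% b2, hE.w, comp_zero])
  refine ⟨_, b, b', j, r, hb, of ?_ ?_ ?_ ?_⟩
  · rw [← cancel_epi a', reassoc_of% hj, hr]; simp
  · intro T x hx
    obtain ⟨T', π, _, y, hy⟩ := hA.surj x
    obtain ⟨z, hz⟩ := hb.lift (y ≫ biprod.inl) (by
      rw [Category.assoc, ← hj, ← reassoc_of% hy, hx, comp_zero])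
    have h2 : z ≫ q = 0 := by
      rw [← cancel_mono c, Category.assoc, ← b2, reassoc_of% hz]; simp
    obtain ⟨z', rfl⟩ := h.lift z h2
    have : y = z' ≫ a := by
      rw [Category.assoc, ib] at hz
      have := congrArg (fun s => s ≫ biprod.fst) hz
      simpa using this.symm
    rw [← cancel_epi π, hy, this, Category.assoc, hA.w, comp_zero, comp_zero]
  · intro T x hx
    obtain ⟨T', π, e, v, hv⟩ := hb.surj x
    obtain ⟨u, hu⟩ := hE.lift (v ≫ biprod.snd) (by
      rw [Category.assoc, ← hr, ← reassoc_of% hv, hx, comp_zero])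
    obtain ⟨T'', π', e', z, hz⟩ := h.surj u
    refine ⟨T'', π' ≫ π, epi_comp _ _, (π' ≫ v ≫ biprod.fst - z ≫ t) ≫ a', ?_⟩
    have key : π' ≫ v = (π' ≫ v ≫ biprod.fst - z ≫ t) ≫ biprod.inl + z ≫ b := by
      apply biprod.hom_ext
      · simp [b1]
      · simp only [Category.assoc, Preadditive.add_comp, biprod.inl_snd, comp_zero, zero_add, b2]
        rw [← hu, reassoc_of% hz]
    rw [Category.assoc, hv, ← Category.assoc, key, Preadditive.add_comp, Category.assoc,
      Category.assoc, Category.assoc, hb.w, comp_zero, add_zero, hj]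
  · have : Epi (b' ≫ r) := by rw [hr]; exact epi_comp _ _
    exact epi_of_epi b' r

end

end SE

section Core

variable {D : Type*} [Category D] [Abelian D]

/-- Closure under extensions. -/
inductive ExtCl (S : Set D) : D → Prop
  | base {A : D} : A ∈ S → ExtCl S A
  | ext {A B E : D} {f : A ⟶ B} {g : B ⟶ E} : SE f g → ExtCl S A → ExtCl S E → ExtCl S B

/-- The formal properties of the vanishing of `Ext^{j+1}(-, 𝒲)`. -/
structure PerpAx (𝒲 : Set D) (p : ℕ → D → Prop) : Prop where
  ext : ∀ {A B E : D} {f : A ⟶ B} {g : B ⟶ E}, SE f g → ∀ j, p j A → p j E → p j B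
  shift : ∀ {A B E : D} {f : A ⟶ B} {g : B ⟶ E}, SE f g → ∀ j, p j A → p (j + 1) B → p (j + 1) E
  zero : ∀ {A B E : D} {f : A ⟶ B} {g : B ⟶ E}, SE f g → p 0 B →
    (∀ W ∈ 𝒲, ∀ φ : A ⟶ W, ∃ ψ : B ⟶ W, f ≫ ψ = φ) → p 0 E
  lift : ∀ {A B E : D} {f : A ⟶ B} {g : B ⟶ E}, SE f g → p 0 E →
    ∀ W ∈ 𝒲, ∀ φ : A ⟶ W, ∃ ψ : B ⟶ W, f ≫ ψ = φ

/-- Classes orthogonal to `𝒲` and cogenerated by `𝒲`. -/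
def CogCls (𝒲 : Set D) (p : ℕ → D → Prop) (E : Set D) : Prop :=
  ∀ U ∈ E, (∀ j, p j U) ∧ ∃ (W U' : D) (f : U ⟶ W) (g : W ⟶ U'), W ∈ 𝒲 ∧ U' ∈ E ∧ SE f g

/-- The largest such class. -/
def BigE (𝒲 : Set D) (p : ℕ → D → Prop) : Set D := {U | ∃ E, CogCls 𝒲 p E ∧ U ∈ E}

theorem bigE_cog (𝒲 : Set D) (p : ℕ → D → Prop) : CogCls 𝒲 p (BigE 𝒲 p) := by
  rintro U ⟨E, hE, hU⟩
  obtain ⟨h1, W, U', f, g, hW, hU', h⟩ := hE U hU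
  exact ⟨h1, W, U', f, g, hW, ⟨E, hE, hU'⟩, h⟩

theorem extCl_cog {𝒲 : Set D} {p : ℕ → D → Prop} (hp : PerpAx 𝒲 p) (hs : SumClosed 𝒲)
    (S : Set D) (hS : ∀ U ∈ S, (∀ j, p j U) ∧ ∃ (W U' : D) (f : U ⟶ W) (g : W ⟶ U'),
      W ∈ 𝒲 ∧ ExtCl S U' ∧ SE f g) : CogCls 𝒲 p {U | ExtCl S U} := by
  intro U hU
  change ExtCl S U at hU
  induction hU with
  | base h => exact hS _ h
  | ext h hA hE ihA ihE =>
    obtain ⟨pA, WA, A', a, a', hWA, hA', sA⟩ := ihA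
    obtain ⟨pE, WE, E', c, c', hWE, hE', sE⟩ := ihE
    obtain ⟨t, ht⟩ := hp.lift h (pE 0) WA hWA a
    obtain ⟨B', b, b', j, r, h1, h2⟩ := SE.horseshoe h sA sE t ht
    exact ⟨fun j => hp.ext h j (pA j) (pE j), _, B', b, b', hs hWA hWE,
      ExtCl.ext h2 hA' hE', h1⟩

theorem core_lemma {𝒲 : Set D} {p : ℕ → D → Prop} (hp : PerpAx 𝒲 p) (hs : SumClosed 𝒲)
    (H : Set D)
    (hR : ∀ N ∈ H, ∃ (P N' : D) (f : N ⟶ P) (g : P ⟶ N'), P ∈ BigE 𝒲 p ∧ N' ∈ H ∧ SE f g)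
    (hL : ∀ N ∈ H, ∃ (N' P : D) (f : N' ⟶ P) (g : P ⟶ N), P ∈ BigE 𝒲 p ∧ N' ∈ H ∧ SE f g ∧
      ∀ W ∈ 𝒲, ∀ φ : N' ⟶ W, ∃ ψ : P ⟶ W, f ≫ ψ = φ) :
    H ⊆ BigE 𝒲 p := by
  have hpH : ∀ j, ∀ N ∈ H, p j N := by
    intro j
    induction j with
    | zero =>
      intro N hN
      obtain ⟨N', P, f, g, hP, -, h, hl⟩ := hL N hN
      exact hp.zero h ((bigE_cog 𝒲 p P hP).1 0) hl
    | succ j ih =>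
      intro N hN
      obtain ⟨N', P, f, g, hP, hN', h, -⟩ := hL N hN
      exact hp.shift h j (ih N' hN') ((bigE_cog 𝒲 p P hP).1 (j + 1))
  intro M hM
  refine ⟨{U | ExtCl (H ∪ BigE 𝒲 p) U}, extCl_cog hp hs _ ?_, ExtCl.base (Or.inl hM)⟩
  rintro U (hU | hU)
  · refine ⟨fun j => hpH j U hU, ?_⟩
    obtain ⟨P, N', f, g, hP, hN', h⟩ := hR U hU
    obtain ⟨-, W, P', i, q, hW, hP', k⟩ := bigE_cog 𝒲 p P hP
    obtain ⟨V, r, a, c, h1, h2⟩ := SE.comp h k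
    exact ⟨W, V, _, r, hW, ExtCl.ext h2 (ExtCl.base (Or.inl hN')) (ExtCl.base (Or.inr hP')), h1⟩
  · obtain ⟨h, W, U', f, g, hW, hU', h'⟩ := bigE_cog 𝒲 p U hU
    exact ⟨h, W, U', f, g, hW, ExtCl.base (Or.inr hU'), h'⟩

theorem cores_of_bigE {𝒲 : Set D} {p : ℕ → D → Prop} (hp : PerpAx 𝒲 p) {M : D}
    (hM : M ∈ BigE 𝒲 p) : MemProperCores 𝒲 M := by
  have H := bigE_cog 𝒲 p
  choose W U' f g hW hU' hfg using fun U : BigE 𝒲 p => (H U.1 U.2).2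
  let nxt : BigE 𝒲 p → BigE 𝒲 p := fun U => ⟨U' U, hU' U⟩
  let s : ℕ → BigE 𝒲 p := fun n => Nat.rec ⟨M, hM⟩ (fun _ U => nxt U) n
  have hl : ∀ (U : BigE 𝒲 p), ∀ V ∈ 𝒲, ∀ φ : U.1 ⟶ V, ∃ ψ : W U ⟶ V, f U ≫ ψ = φ :=
    fun U => hp.lift (hfg U) ((H _ (hU' U)).1 0)
  have w1 : ∀ U : BigE 𝒲 p, f U ≫ g U ≫ f (nxt U) = 0 := fun U => by
    rw [← Category.assoc, (hfg U).w, zero_comp]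
  have w2 : ∀ U : BigE 𝒲 p, (g U ≫ f (nxt U)) ≫ g (nxt U) ≫ f (nxt (nxt U)) = 0 := fun U => by
    rw [Category.assoc, w1 (nxt U), comp_zero]
  have mf : ∀ U, Mono (f U) := fun U => (hfg U).mono
  have eg : ∀ U, Epi (g U) := fun U => (hfg U).epi
  have l1 : ∀ (U : BigE 𝒲 p), ∀ V ∈ 𝒲, ∀ φ : W U ⟶ V, f U ≫ φ = 0 →
      ∃ ψ : W (nxt U) ⟶ V, (g U ≫ f (nxt U)) ≫ ψ = φ := by
    intro U V hV φ h
    obtain ⟨y, hy⟩ := (hfg U).desc φ h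
    obtain ⟨ψ, hψ⟩ := hl (nxt U) V hV y
    exact ⟨ψ, by rw [Category.assoc, hψ, hy]⟩
  refine ⟨fun n => W (s n), fun n => g (s n) ≫ f (nxt (s n)), f ⟨M, hM⟩, fun n => hW _,
    ⟨w1 _, fun n => w2 (s n), mf _, ?_, fun n => ?_⟩, fun V hV => ⟨hl ⟨M, hM⟩ V hV, l1 ⟨M, hM⟩ V hV, ?_⟩⟩
  · rw [ShortComplex.exact_iff_exact_up_to_refinements]
    intro T x hx
    obtain ⟨y, hy⟩ := (hfg ⟨M, hM⟩).lift x (by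
      rw [← cancel_mono (f (nxt ⟨M, hM⟩)), Category.assoc, zero_comp]; exact hx)
    exact ⟨T, 𝟙 _, inferInstance, y, by simpa using hy.symm⟩
  · rw [ShortComplex.exact_iff_exact_up_to_refinements]
    intro T x hx
    obtain ⟨y, hy⟩ := (hfg (nxt (s n))).lift x (by
      rw [← cancel_mono (f (nxt (nxt (s n)))), Category.assoc, zero_comp]; exact hx)
    obtain ⟨T', π, e, z, hz⟩ := (hfg (s n)).surj y
    refine ⟨T', π, e, z, ?_⟩
    rw [← hy, reassoc_of% hz]
  · intro n φ h
    refine l1 (nxt (s n)) V hV φ ?_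
    rw [← cancel_epi (g (s n)), comp_zero, ← Category.assoc]
    exact h

theorem subset_gor (T 𝒳 : Set D) (hT : SumClosed T) (h : T ⊆ 𝒳) : T ⊆ GorClass 𝒳 := by
  intro A hA
  let d : A ⊞ A ⟶ A ⊞ A := biprod.fst ≫ biprod.inr
  have hd : d ≫ d = 0 := by simp [d]
  have key : d ≫ (biprod.snd ≫ biprod.inl) + (biprod.snd ≫ biprod.inl) ≫ d = 𝟙 _ := by
    simp [d, biprod.total]
  have hl : ∀ (V : D) (φ : V ⟶ A ⊞ A), φ ≫ d = 0 → ∃ ψ : V ⟶ A ⊞ A, ψ ≫ d = φ := by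
    intro V φ hφ
    refine ⟨φ ≫ biprod.snd ≫ biprod.inl, ?_⟩
    have := congrArg (fun t => φ ≫ t) key
    simpa [reassoc_of% hφ] using this
  have hr : ∀ (V : D) (φ : A ⊞ A ⟶ V), d ≫ φ = 0 → ∃ ψ : A ⊞ A ⟶ V, d ≫ ψ = φ := by
    intro V φ hφ
    refine ⟨(biprod.snd ≫ biprod.inl) ≫ φ, ?_⟩
    have := congrArg (fun t => t ≫ φ) key
    simpa [hφ] using this
  have w' : d ≫ biprod.fst = 0 := by simp [d]
  refine ⟨fun _ => A ⊞ A, fun _ => d, ⟨fun _ => h (hT hA hA), fun _ => hd, fun _ => ?_,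
    fun V _ _ => hl V, fun V _ _ => hr V⟩, ⟨?_⟩⟩
  · rw [ShortComplex.exact_iff_exact_up_to_refinements]
    intro V x hx
    obtain ⟨y, hy⟩ := hl V x hx
    exact ⟨V, 𝟙 _, inferInstance, y, by simpa using hy.symm⟩
  · refine ⟨cokernel.desc d biprod.fst w', biprod.inl ≫ cokernel.π d, ?_, ?_⟩
    · have : biprod.inr ≫ cokernel.π d = 0 := by
        have : d = biprod.fst ≫ biprod.inr := rfl
        rw [← cancel_epi (biprod.fst : A ⊞ A ⟶ A), ← Category.assoc, ← this, cokernel.condition,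
          comp_zero]
      rw [← cancel_epi (cokernel.π d)]
      apply biprod.hom_ext'
      · simp
      · simp [this]
    · simp

theorem subset_gorIter (T 𝒳 : Set D) (hT : SumClosed T) (h : T ⊆ 𝒳) (n : ℕ) :
    T ⊆ GorIter 𝒳 n := by
  induction n with
  | zero => exact h
  | succ n ih => exact subset_gor T _ hT ih

theorem gor_syzygy (𝒳 : Set D) (M : D) (hM : M ∈ GorClass 𝒳) :
    ∃ H : Set D, M ∈ H ∧
      (∀ N ∈ H, ∃ (P N' : D) (f : N ⟶ P) (g : P ⟶ N'), P ∈ 𝒳 ∧ N' ∈ H ∧ SE f g ∧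
        ∀ W ∈ 𝒳, ∀ φ : W ⟶ N', ∃ ψ : W ⟶ P, ψ ≫ g = φ) ∧
      (∀ N ∈ H, ∃ (N' P : D) (f : N' ⟶ P) (g : P ⟶ N), P ∈ 𝒳 ∧ N' ∈ H ∧ SE f g ∧
        ∀ W ∈ 𝒳, ∀ φ : N' ⟶ W, ∃ ψ : P ⟶ W, f ≫ ψ = φ) := by
  obtain ⟨X, d, hX, hiso⟩ := hM
  -- the embeddings
  let ι : ∀ m : ℤ, cokernel (d (m + 1)) ⟶ X m := fun m => cokernel.desc _ (d m) (hX.w m)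
  have hι : ∀ m, cokernel.π (d (m + 1)) ≫ ι m = d m := fun m => by simp [ι]
  have hse : ∀ m, SE (ι m) (cokernel.π (d m)) := by
    intro m
    have hw : ι m ≫ cokernel.π (d m) = 0 := by
      rw [← cancel_epi (cokernel.π (d (m + 1))), reassoc_of% hι, cokernel.condition, comp_zero]
    refine SE.of hw ?_ ?_ inferInstance
    · intro T x hx
      obtain ⟨T', π, e, y, hy⟩ := surjective_up_to_refinements_of_epi (cokernel.π (d (m + 1))) x
      have h1 : y ≫ d m = 0 := by rw [← hι, ← reassoc_of% hy, hx, comp_zero]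
      obtain ⟨T'', π', e', z, hz⟩ := (hX.exact m).exact_up_to_refinements y h1
      dsimp at hz
      rw [← cancel_epi π, ← cancel_epi π', hy, reassoc_of% hz, cokernel.condition]
      simp
    · intro T x hx
      have he : (ShortComplex.mk (d m) (cokernel.π (d m)) (by simp)).Exact :=
        ShortComplex.exact_of_g_is_cokernel _ (cokernelIsCokernel _)
      obtain ⟨T', π, e, y, hy⟩ := he.exact_up_to_refinements x hx
      exact ⟨T', π, e, y ≫ cokernel.π _, by rw [Category.assoc, hι]; exact hy⟩
  have hliftR : ∀ m, ∀ W ∈ 𝒳, ∀ φ : cokernel (d (m + 1)) ⟶ W, ∃ ψ : X m ⟶ W, ι m ≫ ψ = φ := by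
    intro m W hW φ
    obtain ⟨ψ, hψ⟩ := hX.homExact' W hW m (cokernel.π _ ≫ φ) (by simp)
    exact ⟨ψ, by rw [← cancel_epi (cokernel.π (d (m + 1))), reassoc_of% hι, hψ]⟩
  have hliftL : ∀ m, ∀ W ∈ 𝒳, ∀ φ : W ⟶ cokernel (d m), ∃ ψ : W ⟶ X m,
      ψ ≫ cokernel.π (d m) = φ := by
    intro m
    obtain ⟨l, rfl⟩ : ∃ l : ℤ, m = l + 1 + 1 := ⟨m - 2, by ring⟩
    intro W hW φ
    have := (hse (l + 1)).mono
    obtain ⟨ψ, hψ⟩ := hX.homExact W hW l (φ ≫ ι (l + 1)) (by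
      rw [← hι l, Category.assoc, reassoc_of% (hse (l + 1)).w]; simp)
    exact ⟨ψ, by rw [← cancel_mono (ι (l + 1)), Category.assoc, hι, hψ]⟩
  have tr : ∀ {A B E A' : D} {f : A ⟶ B} {g : B ⟶ E} (e : A ≅ A'), SE f g → SE (e.inv ≫ f) g := by
    intro A B E A' f g e h
    refine ⟨by rw [Category.assoc, h.w, comp_zero], ?_⟩
    refine (ShortComplex.shortExact_iff_of_iso ?_).1 h.ex
    exact ShortComplex.isoMk e (Iso.refl _) (Iso.refl _) (by simp) (by simp)
  have tr' : ∀ {A B E E' : D} {f : A ⟶ B} {g : B ⟶ E} (e : E ≅ E'), SE f g →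
      SE f (g ≫ e.hom) := by
    intro A B E E' f g e h
    refine ⟨by rw [reassoc_of% h.w, zero_comp], ?_⟩
    refine (ShortComplex.shortExact_iff_of_iso ?_).1 h.ex
    exact ShortComplex.isoMk (Iso.refl _) (Iso.refl _) e (by simp) (by simp)
  refine ⟨{N | ∃ n, Nonempty (cokernel (d n) ≅ N)}, ⟨0, hiso⟩, ?_, ?_⟩
  · rintro N ⟨n, ⟨e⟩⟩
    obtain ⟨m, rfl⟩ : ∃ m : ℤ, n = m + 1 := ⟨n - 1, by ring⟩
    exact ⟨X m, cokernel (d m), _, _, hX.mem m, ⟨m, ⟨Iso.refl _⟩⟩, tr e (hse m), hliftL m⟩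
  · rintro N ⟨n, ⟨e⟩⟩
    exact ⟨cokernel (d (n + 1)), X n, _, _, hX.mem n, ⟨n + 1, ⟨Iso.refl _⟩⟩, tr' e (hse n),
      hliftR n⟩

/-- Opposite class. -/
def opCls (S : Set D) : Set Dᵒᵖ := {U | U.unop ∈ S}

theorem gor_sub_bigE {𝒲 𝒳 : Set D} {p : ℕ → D → Prop} (hp : PerpAx 𝒲 p) (hs : SumClosed 𝒲)
    (hWX : 𝒲 ⊆ 𝒳) (h : 𝒳 ⊆ BigE 𝒲 p) (n : ℕ) : GorIter 𝒳 n ⊆ BigE 𝒲 p := by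
  induction n with
  | zero => exact h
  | succ n ih =>
    intro M hM
    obtain ⟨H, hMH, hR, hL⟩ := gor_syzygy _ M hM
    refine core_lemma hp hs H ?_ ?_ hMH
    · intro N hN
      obtain ⟨P, N', f, g, hP, hN', h, -⟩ := hR N hN
      exact ⟨P, N', f, g, ih hP, hN', h⟩
    · intro N hN
      obtain ⟨P, N', f, g, hP, hN', h, hl⟩ := hL N hN
      exact ⟨P, N', f, g, ih hP, hN', h, fun W hW => hl W (subset_gorIter 𝒲 𝒳 hs hWX n hW)⟩

theorem sumClosed_op {𝒱 : Set D} (hi : IsoClosed 𝒱) (hs : SumClosed 𝒱) :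
    SumClosed (opCls 𝒱) := by
  intro A B hA hB
  refine hi ?_ (hs hA hB)
  have e : Opposite.op (A.unop ⊞ B.unop) ≅ A ⊞ B :=
    { hom := biprod.lift (biprod.inl.op : Opposite.op (A.unop ⊞ B.unop) ⟶ A) biprod.inr.op
      inv := biprod.desc (biprod.fst.op : A ⟶ Opposite.op (A.unop ⊞ B.unop)) biprod.snd.op
      hom_inv_id := by
        rw [biprod.lift_desc, ← op_comp, ← op_comp, ← op_add, biprod.total]; rfl
      inv_hom_id := by
        apply biprod.hom_ext' <;> apply biprod.hom_ext <;> simp [← op_comp] }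
  exact e.unop.symm

theorem gor_sub_bigE_op {𝒱 𝒴 : Set D} {p : ℕ → Dᵒᵖ → Prop} (hp : PerpAx (opCls 𝒱) p)
    (hi : IsoClosed 𝒱) (hs : SumClosed 𝒱)
    (hWX : 𝒱 ⊆ 𝒴) (h : opCls 𝒴 ⊆ BigE (opCls 𝒱) p) (n : ℕ) :
    opCls (GorIter 𝒴 n) ⊆ BigE (opCls 𝒱) p := by
  induction n with
  | zero => exact h
  | succ n ih =>
    intro M hM
    obtain ⟨H, hMH, hR, hL⟩ := gor_syzygy _ M.unop hM
    refine core_lemma hp (sumClosed_op hi hs) (opCls H) ?_ ?_ hMH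
    · intro N hN
      obtain ⟨N', P, f, g, hP, hN', h, -⟩ := hL N.unop hN
      exact ⟨Opposite.op P, Opposite.op N', g.op, f.op, ih hP, hN', h.op'⟩
    · intro N hN
      obtain ⟨P, N', f, g, hP, hN', h, hl⟩ := hR N.unop hN
      refine ⟨Opposite.op N', Opposite.op P, g.op, f.op, ih hP, hN', h.op', fun W hW φ => ?_⟩
      obtain ⟨ψ, hψ⟩ := hl W.unop (subset_gorIter 𝒱 𝒴 hs hWX n hW) φ.unop
      exact ⟨ψ.op, by rw [← op_comp, hψ]; rfl⟩

theorem res_of_cores_op {𝒱 : Set D} {M : D} (h : MemProperCores (opCls 𝒱) (Opposite.op M)) :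
    MemProperRes 𝒱 M := by
  obtain ⟨Q, δ, η, hQ, hc, hh⟩ := h
  have := hc.mono
  refine ⟨fun n => (Q n).unop, fun n => (δ n).unop, η.unop, hQ,
    ⟨congrArg Quiver.Hom.unop hc.w0, fun n => congrArg Quiver.Hom.unop (hc.w n), 
      (inferInstance : Epi η.unop), hc.exact0.unop, fun n => (hc.exact n).unop⟩, fun V hV => ?_⟩
  obtain ⟨h1, h2, h3⟩ := hh (Opposite.op V) hV
  refine ⟨fun φ => ?_, fun φ hφ => ?_, fun n φ hφ => ?_⟩
  · obtain ⟨ψ, hψ⟩ := h1 φ.op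
    exact ⟨ψ.unop, congrArg Quiver.Hom.unop hψ⟩
  · obtain ⟨ψ, hψ⟩ := h2 φ.op (congrArg Quiver.Hom.op hφ)
    exact ⟨ψ.unop, congrArg Quiver.Hom.unop hψ⟩
  · obtain ⟨ψ, hψ⟩ := h3 n φ.op (congrArg Quiver.Hom.op hφ)
    exact ⟨ψ.unop, congrArg Quiver.Hom.unop hψ⟩

end Core

section ExtPart

variable {D : Type u} [Category.{v} D] [Abelian D] [HasExt.{w} D]

theorem perpAx_inj (𝒲 : Set D) :
    PerpAx 𝒲 (fun j M => ∀ W ∈ 𝒲, ∀ x : Abelian.Ext M W (j + 1), x = 0) where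
  ext h j hA hE W hW x := by
    obtain ⟨y, rfl⟩ := Ext.contravariant_sequence_exact₂ h.ex W x (hA W hW _)
    rw [hE W hW y, Ext.comp_zero]
  shift h j hA hB W hW x := by
    obtain ⟨y, rfl⟩ := Ext.contravariant_sequence_exact₃ h.ex W x (hB W hW _)
      (show 1 + (j + 1) = j + 1 + 1 by omega)
    rw [hA W hW y, Ext.comp_zero]
  zero h hB hl W hW x := by
    obtain ⟨y, rfl⟩ := Ext.contravariant_sequence_exact₃ h.ex W x (hB W hW _)
      (show 1 + 0 = 0 + 1 by omega)
    obtain ⟨φ, rfl⟩ := (Ext.mk₀_bijective _ _).2 y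
    obtain ⟨ψ, rfl⟩ := hl W hW φ
    rw [← Ext.mk₀_comp_mk₀]
    exact h.ex.extClass_comp_assoc _
  lift h hE W hW φ := by
    obtain ⟨y, hy⟩ := Ext.contravariant_sequence_exact₁ h.ex W (Ext.mk₀ φ)
      (show 1 + 0 = 0 + 1 by omega) (hE W hW _)
    obtain ⟨ψ, rfl⟩ := (Ext.mk₀_bijective _ _).2 y
    refine ⟨ψ, (Ext.mk₀_bijective _ _).1 ?_⟩
    rw [← hy, Ext.mk₀_comp_mk₀]

theorem perpAx_proj (𝒱 : Set D) :
    PerpAx (opCls 𝒱) (fun j M => ∀ V ∈ 𝒱, ∀ x : Abelian.Ext V M.unop (j + 1), x = 0) where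
  ext h j hA hE V hV x := by
    obtain ⟨y, rfl⟩ := Ext.covariant_sequence_exact₂ V h.unop'.ex x (hA V hV _)
    rw [hE V hV y, Ext.zero_comp]
  shift h j hA hB V hV x := by
    obtain ⟨y, rfl⟩ := Ext.covariant_sequence_exact₁ V h.unop'.ex x (hB V hV _) rfl
    rw [hA V hV y, Ext.zero_comp]
  zero h hB hl V hV x := by
    obtain ⟨y, rfl⟩ := Ext.covariant_sequence_exact₁ V h.unop'.ex x (hB V hV _) rfl
    obtain ⟨φ, rfl⟩ := (Ext.mk₀_bijective _ _).2 y
    obtain ⟨ψ, hψ⟩ := hl (Opposite.op V) hV φ.op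
    have : φ = ψ.unop ≫ _ := congrArg Quiver.Hom.unop hψ.symm
    rw [this, ← Ext.mk₀_comp_mk₀, Ext.comp_assoc_of_second_deg_zero]
    erw [h.unop'.ex.comp_extClass]
    rw [Ext.comp_zero]
  lift h hE V hV φ := by
    obtain ⟨y, hy⟩ := Ext.covariant_sequence_exact₃ _ h.unop'.ex (Ext.mk₀ φ.unop)
      rfl (hE _ hV _)
    obtain ⟨ψ, rfl⟩ := (Ext.mk₀_bijective _ _).2 y
    refine ⟨ψ.op, Quiver.Hom.unop_inj ((Ext.mk₀_bijective _ _).1 ?_)⟩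
    rw [← hy, Ext.mk₀_comp_mk₀]
    rfl

end ExtPart


variable [EnoughProjectives C] [EnoughInjectives C] [HasExt.{w} C]

/-- Theorem 3.8: (a) if `𝒲` is an injective cogenerator for `𝒳` and `𝒳` is
closed under extensions, then `G^n(𝒳) ⊆ cores~(𝒲)` for each `n ≥ 0`; (b) dually,
`G^n(𝒴) ⊆ res~(𝒱)`. -/
theorem stmt_13 (𝒲 𝒳 𝒱 𝒴 : Set C)
    (h𝒲iso : IsoClosed 𝒲) (h𝒲sum : SumClosed 𝒲)
    (h𝒳iso : IsoClosed 𝒳) (h𝒳sum : SumClosed 𝒳)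
    (h𝒱iso : IsoClosed 𝒱) (h𝒱sum : SumClosed 𝒱)
    (h𝒴iso : IsoClosed 𝒴) (h𝒴sum : SumClosed 𝒴) :
    (IsInjCogen 𝒲 𝒳 → ExtensionClosed 𝒳 →
      ∀ (n : ℕ), ∀ M ∈ GorIter 𝒳 n, MemProperCores 𝒲 M) ∧
    (IsProjGen 𝒱 𝒴 → ExtensionClosed 𝒴 →
      ∀ (n : ℕ), ∀ M ∈ GorIter 𝒴 n, MemProperRes 𝒱 M) := by
  refine ⟨fun h _ n M hM => ?_, fun h _ n M hM => ?_⟩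
  · have hp := perpAx_inj 𝒲
    refine cores_of_bigE hp (gor_sub_bigE hp h𝒲sum h.1.1 ?_ n hM)
    intro X hX
    refine ⟨𝒳, fun U hU => ⟨fun j W hW x => ?_, ?_⟩, hX⟩
    · have := h.2 U hU W hW (j + 1) (by omega)
      exact Subsingleton.elim _ _
    · obtain ⟨W, X', i, p, w, hW, hX', hs⟩ := h.1.2 U hU
      exact ⟨W, X', i, p, hW, hX', ⟨w, hs⟩⟩
  · have hp := perpAx_proj 𝒱
    refine res_of_cores_op (cores_of_bigE hp (gor_sub_bigE_op hp h𝒱iso h𝒱sum h.1.1 ?_ n hM))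
    intro Y hY
    refine ⟨opCls 𝒴, fun U hU => ⟨fun j V hV x => ?_, ?_⟩, hY⟩
    · have := h.2 V hV U.unop hU (j + 1) (by omega)
      exact Subsingleton.elim _ _
    · obtain ⟨Y', V, i, p, w, hV, hY', hs⟩ := h.1.2 U.unop hU
      exact ⟨Opposite.op V, Opposite.op Y', p.op, i.op, hV, hY', SE.op' ⟨w, hs⟩⟩
end

section
/- If X is closed under extensions and W is both an injective cogenerator and a projective generator for X, then G^n(X) ⊆ G(W) for each n ≥ 1. -/
open CategoryTheory CategoryTheory.Limits CategoryTheory.Abelian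

universe w v u

variable {C : Type u} [Category.{v} C] [Abelian C]

section Abstract

/-- right-good class -/
def RGood {T : Type*} (S : T → T → T → Prop) (E : T → T → Prop) (W : Set T) (𝒮 : Set T) : Prop :=
  ∀ N ∈ 𝒮, (∀ V ∈ W, E N V ∧ E V N) ∧ ∃ V ∈ W, ∃ N' ∈ 𝒮, S N V N'

def GR {T : Type*} (S : T → T → T → Prop) (E : T → T → Prop) (W : Set T) : Set T :=
  {N | ∃ 𝒮, RGood S E W 𝒮 ∧ N ∈ 𝒮}

/-- The formal properties used. -/
structure AbsAx {T : Type*} (S : T → T → T → Prop) (E : T → T → Prop) (W : Set T) : Prop where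
  comp : ∀ A B D B' D', S A B D → S B B' D' → ∃ F, S A B' F ∧ S D F D'
  push : ∀ A B D B' D', S A B D → S A B' D' → ∃ P, S B P D' ∧ S B' P D
  split : ∀ V P D V' D', V ∈ W → V' ∈ W → S V P D → E D V → S D V' D' → ∃ U ∈ W, S P U D'
  ext1 : ∀ A B D V, S A B D → E A V → E D V → E B V
  ext2 : ∀ A B D V, S A B D → E V A → E V D → E V B

variable {T : Type*} {S : T → T → T → Prop} {E : T → T → Prop} {W : Set T}

theorem rgood_GR : RGood S E W (GR S E W) := by
  rintro N ⟨𝒮, h𝒮, hN⟩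
  obtain ⟨h, V, hV, N', hN', hs⟩ := h𝒮 N hN
  exact ⟨h, V, hV, N', ⟨𝒮, h𝒮, hN'⟩, hs⟩

theorem GR_ext (ax : AbsAx S E W) {A B D : T} (h : S A B D) (hA : A ∈ GR S E W)
    (hD : D ∈ GR S E W) : B ∈ GR S E W := by
  refine ⟨{B | ∃ A D, S A B D ∧ A ∈ GR S E W ∧ D ∈ GR S E W}, ?_, A, D, h, hA, hD⟩
  rintro B ⟨A, D, h, hA, hD⟩
  obtain ⟨eA, V, hV, A', hA', sA⟩ := rgood_GR A hA
  obtain ⟨eD, V', hV', D', hD', sD⟩ := rgood_GR D hD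
  refine ⟨fun V hV => ⟨ax.ext1 _ _ _ _ h (eA V hV).1 (eD V hV).1,
    ax.ext2 _ _ _ _ h (eA V hV).2 (eD V hV).2⟩, ?_⟩
  obtain ⟨P, h1, h2⟩ := ax.push _ _ _ _ _ h sA
  obtain ⟨U, hU, h3⟩ := ax.split _ _ _ _ _ hV hV' h2 (eD V hV).1 sD
  obtain ⟨B', h4, h5⟩ := ax.comp _ _ _ _ _ h1 h3
  exact ⟨U, hU, B', ⟨A', D', h5, hA', hD'⟩, h4⟩

theorem GR_of (ax : AbsAx S E W) (ℳ : Set T)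
    (h : ∀ M ∈ ℳ, (∀ V ∈ W, E M V ∧ E V M) ∧ ∃ Y ∈ GR S E W, ∃ M' ∈ ℳ, S M Y M') :
    ℳ ⊆ GR S E W := by
  intro M hM
  refine ⟨{N | (∀ V ∈ W, E N V ∧ E V N) ∧ ∃ G ∈ GR S E W, ∃ M ∈ ℳ, S N G M}, ?_, h M hM⟩
  rintro N ⟨eN, G, hG, M, hM, hs⟩
  refine ⟨eN, ?_⟩
  obtain ⟨eG, V, hV, G', hG', sG⟩ := rgood_GR G hG
  obtain ⟨eG', -⟩ := rgood_GR G' hG'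
  obtain ⟨N', h1, h2⟩ := ax.comp _ _ _ _ _ hs sG
  obtain ⟨eM, Y, hY, M', hM', sM⟩ := h M hM
  obtain ⟨P, h3, h4⟩ := ax.push _ _ _ _ _ h2 sM
  exact ⟨V, hV, N', ⟨fun V hV => ⟨ax.ext1 _ _ _ _ h2 (eM V hV).1 (eG' V hV).1,
    ax.ext2 _ _ _ _ h2 (eM V hV).2 (eG' V hV).2⟩, P, GR_ext ax h4 hY hG', M', hM', h3⟩, h1⟩

theorem GR_seq {M : T} (hM : M ∈ GR S E W) : ∃ Z : ℕ → T, Z 0 = M ∧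
    (∀ n, ∀ V ∈ W, E (Z n) V ∧ E V (Z n)) ∧ ∀ n, ∃ V ∈ W, S (Z n) V (Z (n + 1)) := by
  have h : ∀ x : GR S E W, ∃ y : GR S E W, ∃ V ∈ W, S x.1 V y.1 := by
    rintro ⟨N, hN⟩
    obtain ⟨-, V, hV, N', hN', hs⟩ := rgood_GR N hN
    exact ⟨⟨N', hN'⟩, V, hV, hs⟩
  choose f hf using h
  refine ⟨fun n => (f^[n] ⟨M, hM⟩).1, rfl, fun n => (rgood_GR _ (f^[n] ⟨M, hM⟩).2).1, fun n => ?_⟩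
  simp only [Function.iterate_succ_apply']
  exact hf _

end Abstract

section SesLemmas

def Ses (A B D : C) : Prop :=
  ∃ (f : A ⟶ B) (g : B ⟶ D) (w : f ≫ g = 0), (ShortComplex.mk f g w).ShortExact

theorem Ses.congr {A B D A' B' D' : C} (h : Ses A B D) (a : A ≅ A') (b : B ≅ B') (d : D ≅ D') :
    Ses A' B' D' := by
  obtain ⟨f, g, w, h⟩ := h
  refine ⟨a.inv ≫ f ≫ b.hom, b.inv ≫ g ≫ d.hom, by simp [reassoc_of% w], ?_⟩
  refine ShortComplex.shortExact_of_iso (ShortComplex.isoMk a b d ?_ ?_) h <;> simp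

theorem ses_cokernel {A B : C} (f : A ⟶ B) [Mono f] : Ses A B (cokernel f) :=
  ⟨f, cokernel.π f, by simp,
    { exact := ShortComplex.exact_cokernel f }⟩

theorem Ses.exists_cok {A B D : C} (h : Ses A B D) :
    ∃ f : A ⟶ B, Mono f ∧ Nonempty (cokernel f ≅ D) := by
  obtain ⟨f, g, w, h⟩ := h
  exact ⟨f, h.mono_f, ⟨(cokernelIsCokernel f).coconePointUniqueUpToIso h.gIsCokernel⟩⟩

theorem ses_comp {A B D B' D' : C} (h : Ses A B D) (h' : Ses B B' D') :
    ∃ F, Ses A B' F ∧ Ses D F D' := by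
  obtain ⟨f, _, ⟨i⟩⟩ := h.exists_cok
  obtain ⟨f', _, ⟨i'⟩⟩ := h'.exists_cok
  refine ⟨cokernel (f ≫ f'), ses_cokernel _, Ses.congr ?_ i (Iso.refl _) i'⟩
  refine ⟨cokernel.map f (f ≫ f') (𝟙 _) f' (by simp),
    cokernel.map (f ≫ f') f' f (𝟙 _) (by simp), ?_, ?_⟩
  · ext; simp
  · have e := kernelCokernelCompSequence_exact f f'
    have hm : Mono (cokernel.map f (f ≫ f') (𝟙 _) f' (by simp)) := by
      refine (e.exact 2).mono_g_iff.2 ?_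
      exact (isZero_kernel_of_mono f').eq_of_src _ _
    have he : Epi (cokernel.map (f ≫ f') f' f (𝟙 _) (by simp)) := by
      apply epi_of_epi_fac (f := cokernel.π (f ≫ f')) (h := cokernel.π f')
      simp
    exact { exact := e.exact 3, mono_f := hm, epi_g := he }

theorem ses_push {A B D B' D' : C} (h : Ses A B D) (h' : Ses A B' D') :
    ∃ P, Ses B P D' ∧ Ses B' P D := by
  obtain ⟨f, _, ⟨i⟩⟩ := h.exists_cok
  obtain ⟨f', _, ⟨i'⟩⟩ := h'.exists_cok
  refine ⟨pushout f f', Ses.congr ?_ (Iso.refl _) (Iso.refl _) i',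
    Ses.congr ?_ (Iso.refl _) (Iso.refl _) i⟩
  · obtain ⟨q, hq1, hq2⟩ : ∃ q : pushout f f' ⟶ cokernel f',
        pushout.inl f f' ≫ q = 0 ∧ pushout.inr f f' ≫ q = cokernel.π f' :=
      ⟨pushout.desc 0 (cokernel.π f') (by rw [comp_zero, cokernel.condition]), pushout.inl_desc _ _ _, pushout.inr_desc _ _ _⟩
    refine ⟨pushout.inl f f', q, hq1, ?_⟩
    have : Epi q := epi_of_epi_fac hq2
    refine { exact := ShortComplex.exact_of_g_is_cokernel _
              (CokernelCofork.IsColimit.ofπ' _ _ fun {Z} k hk =>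
                ⟨cokernel.desc f' (pushout.inr f f' ≫ k) ?_, ?_⟩) }
    · rw [← pushout.condition_assoc, hk, comp_zero]
    · dsimp at hk ⊢
      apply pushout.hom_ext <;> simp [hk, reassoc_of% hq1, reassoc_of% hq2]
  · obtain ⟨q, hq1, hq2⟩ : ∃ q : pushout f f' ⟶ cokernel f,
        pushout.inr f f' ≫ q = 0 ∧ pushout.inl f f' ≫ q = cokernel.π f :=
      ⟨pushout.desc (cokernel.π f) 0 (by rw [comp_zero, cokernel.condition]), pushout.inr_desc _ _ _, pushout.inl_desc _ _ _⟩
    refine ⟨pushout.inr f f', q, hq1, ?_⟩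
    have : Epi q := epi_of_epi_fac hq2
    refine { exact := ShortComplex.exact_of_g_is_cokernel _
              (CokernelCofork.IsColimit.ofπ' _ _ fun {Z} k hk =>
                ⟨cokernel.desc f (pushout.inl f f' ≫ k) ?_, ?_⟩) }
    · rw [pushout.condition_assoc, hk, comp_zero]
    · dsimp at hk ⊢
      apply pushout.hom_ext <;> simp [hk, reassoc_of% hq1, reassoc_of% hq2]

theorem Ses.op {A B D : C} (h : Ses A B D) : Ses (Opposite.op D) (Opposite.op B) (Opposite.op A) := by
  obtain ⟨f, g, w, h⟩ := h
  exact ⟨_, _, _, h.op⟩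

theorem Ses.unop {A B D : Cᵒᵖ} (h : Ses A B D) : Ses D.unop B.unop A.unop := by
  obtain ⟨f, g, w, h⟩ := h
  exact ⟨_, _, _, h.unop⟩

theorem ses_comp' {A B D B' D' : C} (h : Ses D B A) (h' : Ses D' B' B) :
    ∃ F, Ses F B' A ∧ Ses D' F D := by
  obtain ⟨F, h1, h2⟩ := ses_comp h.op h'.op
  exact ⟨F.unop, h1.unop, h2.unop⟩

theorem ses_pull {A B D B' D' : C} (h : Ses D B A) (h' : Ses D' B' A) :
    ∃ P, Ses D' P B ∧ Ses D P B' := by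
  obtain ⟨F, h1, h2⟩ := ses_push h.op h'.op
  exact ⟨F.unop, h1.unop, h2.unop⟩

theorem ses_biprod {V D V' D' : C} (h : Ses D V' D') : Ses (V ⊞ D) (V ⊞ V') D' := by
  obtain ⟨f, g, w, h⟩ := h
  have := h.mono_f
  have := h.epi_g
  dsimp at *
  refine ⟨biprod.map (𝟙 V) f, biprod.snd ≫ g, by simp [w], ?_⟩
  refine { exact := ShortComplex.exact_of_g_is_cokernel _
            (CokernelCofork.IsColimit.ofπ' _ _ fun {Z} k hk => ?_)
           mono_f := inferInstanceAs (Mono (biprod.map (𝟙 V) f))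
           epi_g := inferInstanceAs (Epi (biprod.snd ≫ g)) }
  have h1 : biprod.inl ≫ k = 0 := by
    have := biprod.inl ≫= hk
    simpa using this
  have h2 : f ≫ biprod.inr ≫ k = 0 := by
    have := biprod.inr ≫= hk
    simpa using this
  refine ⟨h.gIsCokernel.desc (CokernelCofork.ofπ (biprod.inr ≫ k) h2), ?_⟩
  have h3 : g ≫ h.gIsCokernel.desc (CokernelCofork.ofπ (biprod.inr ≫ k) h2) = biprod.inr ≫ k :=
    h.gIsCokernel.fac (CokernelCofork.ofπ (biprod.inr ≫ k) h2) WalkingParallelPair.one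
  dsimp at h3 ⊢
  apply biprod.hom_ext' <;> simp [h1, h3]

theorem ses_biprod' {V D V' D' : C} (h : Ses D' V' D) : Ses D' (V' ⊞ V) (D ⊞ V) := by
  obtain ⟨f, g, w, h⟩ := h
  have := h.mono_f
  have := h.epi_g
  dsimp at *
  refine ⟨f ≫ biprod.inl, biprod.map g (𝟙 V), by simp [reassoc_of% w], ?_⟩
  refine { exact := ShortComplex.exact_of_f_is_kernel _
            (KernelFork.IsLimit.ofι' _ _ fun {Z} k hk => ?_)
           mono_f := inferInstanceAs (Mono (f ≫ biprod.inl))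
           epi_g := inferInstanceAs (Epi (biprod.map g (𝟙 V))) }
  have h1 : k ≫ biprod.snd = 0 := by
    have := hk =≫ biprod.snd
    simpa using this
  have h2 : (k ≫ biprod.fst) ≫ g = 0 := by
    have := hk =≫ biprod.fst
    simpa using this
  refine ⟨h.fIsKernel.lift (KernelFork.ofι (k ≫ biprod.fst) h2), ?_⟩
  have h3 : h.fIsKernel.lift (KernelFork.ofι (k ≫ biprod.fst) h2) ≫ f = k ≫ biprod.fst :=
    h.fIsKernel.fac (KernelFork.ofι (k ≫ biprod.fst) h2) WalkingParallelPair.zero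
  dsimp at h3 ⊢
  apply biprod.hom_ext <;> simp [h1, h3, reassoc_of% h3]

end SesLemmas

section ExtLemmas

variable [HasExt.{w} C]

abbrev E1 (A B : C) : Prop := Subsingleton (Abelian.Ext.{w} A B 1)

theorem extend_of_E1 {S : ShortComplex C} (hS : S.ShortExact) {Y : C} (h : E1.{w} S.X₃ Y)
    (φ : S.X₁ ⟶ Y) : ∃ ψ : S.X₂ ⟶ Y, S.f ≫ ψ = φ := by
  have := h
  obtain ⟨x, hx⟩ := Ext.contravariant_sequence_exact₁ hS Y (Ext.mk₀ φ) (add_zero 1)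
    (Subsingleton.elim (α := Abelian.Ext.{w} S.X₃ Y 1) _ _)
  obtain ⟨ψ, rfl⟩ := (Ext.mk₀_bijective _ _).2 x
  refine ⟨ψ, (Ext.mk₀_bijective _ _).1 ?_⟩
  rw [← hx, Ext.mk₀_comp_mk₀]

theorem lift_of_E1 {S : ShortComplex C} (hS : S.ShortExact) {Y : C} (h : E1.{w} Y S.X₁)
    (φ : Y ⟶ S.X₃) : ∃ ψ : Y ⟶ S.X₂, ψ ≫ S.g = φ := by
  have := h
  obtain ⟨x, hx⟩ := Ext.covariant_sequence_exact₃ Y hS (Ext.mk₀ φ) (zero_add 1)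
    (Subsingleton.elim (α := Abelian.Ext.{w} Y S.X₁ 1) _ _)
  obtain ⟨ψ, rfl⟩ := (Ext.mk₀_bijective _ _).2 x
  refine ⟨ψ, (Ext.mk₀_bijective _ _).1 ?_⟩
  rw [← hx, Ext.mk₀_comp_mk₀]

theorem subs_of {A B : C} (h : ∀ x : Abelian.Ext.{w} A B 1, x = 0) : E1.{w} A B :=
  ⟨fun a b => (h a).trans (h b).symm⟩

theorem E1_ext1 {A B D V : C} (h : Ses A B D) (hA : E1.{w} A V) (hD : E1.{w} D V) :
    E1.{w} B V := by
  obtain ⟨f, g, w, hS⟩ := h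
  refine subs_of fun x => ?_
  have := hA
  have := hD
  obtain ⟨y, rfl⟩ := Ext.contravariant_sequence_exact₂ hS V x
    (Subsingleton.elim (α := Abelian.Ext.{w} A V 1) _ _)
  rw [Subsingleton.elim (α := Abelian.Ext.{w} D V 1) y 0, Ext.comp_zero]

theorem E1_ext2 {A B D V : C} (h : Ses A B D) (hA : E1.{w} V A) (hD : E1.{w} V D) :
    E1.{w} V B := by
  obtain ⟨f, g, w, hS⟩ := h
  refine subs_of fun x => ?_
  have := hA
  have := hD
  obtain ⟨y, rfl⟩ := Ext.covariant_sequence_exact₂ V hS x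
    (Subsingleton.elim (α := Abelian.Ext.{w} V D 1) _ _)
  rw [Subsingleton.elim (α := Abelian.Ext.{w} V A 1) y 0, Ext.zero_comp]

theorem E1_of_extend {S : ShortComplex C} (hS : S.ShortExact) {Y : C} (h : E1.{w} S.X₂ Y)
    (hφ : ∀ φ : S.X₁ ⟶ Y, ∃ ψ : S.X₂ ⟶ Y, S.f ≫ ψ = φ) : E1.{w} S.X₃ Y := by
  refine subs_of fun x => ?_
  have := h
  obtain ⟨y, rfl⟩ := Ext.contravariant_sequence_exact₃ hS Y x
    (Subsingleton.elim (α := Abelian.Ext.{w} S.X₂ Y 1) _ _) (add_zero 1)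
  obtain ⟨φ, rfl⟩ := (Ext.mk₀_bijective _ _).2 y
  obtain ⟨ψ, rfl⟩ := hφ φ
  rw [← Ext.mk₀_comp_mk₀, hS.extClass_comp_assoc]

theorem E1_of_lift {S : ShortComplex C} (hS : S.ShortExact) {Y : C} (h : E1.{w} Y S.X₂)
    (hφ : ∀ φ : Y ⟶ S.X₃, ∃ ψ : Y ⟶ S.X₂, ψ ≫ S.g = φ) : E1.{w} Y S.X₁ := by
  refine subs_of fun x => ?_
  have := h
  obtain ⟨y, rfl⟩ := Ext.covariant_sequence_exact₁ Y hS x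
    (Subsingleton.elim (α := Abelian.Ext.{w} Y S.X₂ 1) _ _) (zero_add 1)
  obtain ⟨φ, rfl⟩ := (Ext.mk₀_bijective _ _).2 y
  obtain ⟨ψ, rfl⟩ := hφ φ
  rw [← Ext.mk₀_comp_mk₀, Ext.comp_assoc_of_second_deg_zero, hS.comp_extClass, Ext.comp_zero]

theorem ses_split {V P D : C} (h : Ses V P D) (hE : E1.{w} D V) : Nonempty (P ≅ V ⊞ D) := by
  obtain ⟨f, g, w, hS⟩ := h
  obtain ⟨r, hr⟩ := extend_of_E1 hS hE (𝟙 V)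
  have := hS.epi_g
  exact ⟨(ShortComplex.Splitting.ofExactOfRetraction _ hS.exact r hr hS.epi_g).isoBinaryBiproduct⟩

theorem absAx (𝒲 : Set C) (hs : SumClosed 𝒲) : AbsAx (Ses (C := C)) E1.{w} 𝒲 where
  comp _ _ _ _ _ h h' := ses_comp h h'
  push _ _ _ _ _ h h' := ses_push h h'
  split V P D V' D' hV hV' h1 hE h2 := by
    obtain ⟨i⟩ := ses_split h1 hE
    exact ⟨V ⊞ V', hs hV hV', (ses_biprod h2).congr i.symm (Iso.refl _) (Iso.refl _)⟩
  ext1 _ _ _ _ h h1 h2 := E1_ext1 h h1 h2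
  ext2 _ _ _ _ h h1 h2 := E1_ext2 h h1 h2

theorem absAx' (𝒲 : Set C) (hs : SumClosed 𝒲) :
    AbsAx (fun A B D : C => Ses D B A) (fun A B => E1.{w} B A) 𝒲 where
  comp _ _ _ _ _ h h' := ses_comp' h h'
  push _ _ _ _ _ h h' := ses_pull h h'
  split V P D V' D' hV hV' h1 hE h2 := by
    obtain ⟨i⟩ := ses_split h1 hE
    exact ⟨V' ⊞ V, hs hV' hV, (ses_biprod' h2).congr (Iso.refl _) (Iso.refl _) i.symm⟩
  ext1 _ _ _ _ h h1 h2 := E1_ext2 h h2 h1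
  ext2 _ _ _ _ h h1 h2 := E1_ext1 h h2 h1

theorem E1_iso {A A' B B' : C} (a : A ≅ A') (b : B ≅ B') (h : E1.{w} A B) : E1.{w} A' B' := by
  have := h
  refine subs_of fun x => ?_
  have h2 : ((Ext.mk₀ a.hom).comp (x.comp (Ext.mk₀ b.inv) (add_zero 1)) (zero_add 1)) = 0 :=
    Subsingleton.elim (α := Abelian.Ext.{w} A B 1) _ _
  have h3 : (Ext.mk₀ a.inv).comp
    (((Ext.mk₀ a.hom).comp (x.comp (Ext.mk₀ b.inv) (add_zero 1)) (zero_add 1)).comp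
      (Ext.mk₀ b.hom) (add_zero 1)) (zero_add 1) = x := by
    simp
  rw [← h3, h2]
  simp

/-- cycles of a totally acyclic complex -/
def Cyc (𝒴 : Set C) : Set C :=
  {M | ∃ (X : ℤ → C) (d : ∀ n : ℤ, X (n + 1) ⟶ X n),
    IsTotallyAcyclic 𝒴 X d ∧ ∃ n, Nonempty (cokernel (d n) ≅ M)}

theorem ta_ses {𝒴 : Set C} {X : ℤ → C} {d : ∀ n : ℤ, X (n + 1) ⟶ X n}
    (h : IsTotallyAcyclic 𝒴 X d) (n : ℤ) :
    (ShortComplex.mk (cokernel.desc (d (n + 1)) (d n) (h.w n)) (cokernel.π (d n))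
      (by ext; simp)).ShortExact := by
  have hm : Mono (cokernel.desc (d (n + 1)) (d n) (h.w n)) :=
    (h.exact n).mono_cokernelDesc
  refine { exact := ShortComplex.exact_of_g_is_cokernel _
            (CokernelCofork.IsColimit.ofπ' _ _ fun {Z} k hk => ⟨cokernel.desc (d n) k ?_, ?_⟩)
           mono_f := hm, epi_g := inferInstanceAs (Epi (cokernel.π _)) }
  · dsimp at hk
    have := cokernel.π (d (n + 1)) ≫= hk
    simpa using this
  · simp

theorem cyc_E1 {𝒴 : Set C} {X : ℤ → C} {d : ∀ n : ℤ, X (n + 1) ⟶ X n}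
    (h : IsTotallyAcyclic 𝒴 X d) {V : C} (hV : V ∈ 𝒴) (hY : ∀ Y ∈ 𝒴, E1.{w} Y V) (n : ℤ) :
    E1.{w} (cokernel (d n)) V := by
  refine E1_of_extend (ta_ses h n) (hY _ (h.mem n)) fun φ => ?_
  dsimp at φ ⊢
  obtain ⟨ψ, hψ⟩ := h.homExact' V hV n (cokernel.π _ ≫ φ) (by simp)
  refine ⟨ψ, ?_⟩
  ext
  simpa using hψ

theorem cyc_E1' {𝒴 : Set C} {X : ℤ → C} {d : ∀ n : ℤ, X (n + 1) ⟶ X n}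
    (h : IsTotallyAcyclic 𝒴 X d) {V : C} (hV : V ∈ 𝒴) (hY : ∀ Y ∈ 𝒴, E1.{w} V Y) (n : ℤ) :
    E1.{w} V (cokernel (d n)) := by
  obtain ⟨n, rfl⟩ : ∃ m, n = m + 1 + 1 + 1 := ⟨n - 3, by ring⟩
  refine E1_of_lift (ta_ses h (n + 1 + 1)) (hY _ (h.mem _)) fun φ => ?_
  have hm := (ta_ses h (n + 1)).mono_f
  dsimp at φ hm ⊢
  obtain ⟨ψ, hψ⟩ := h.homExact V hV n
    (φ ≫ cokernel.desc (d (n + 1 + 1)) (d (n + 1)) (h.w (n + 1))) (by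
      have : cokernel.desc (d (n + 1 + 1)) (d (n + 1)) (h.w (n + 1)) ≫ d n = 0 := by
        ext; simp [h.w]
      simp [this])
  refine ⟨ψ, ?_⟩
  rw [← cancel_mono (cokernel.desc (d (n + 1 + 1)) (d (n + 1)) (h.w (n + 1)))]
  simpa using hψ

theorem gor_sub_R {𝒲 𝒴 : Set C} (hs : SumClosed 𝒲) (h1 : 𝒲 ⊆ 𝒴)
    (h2 : 𝒴 ⊆ GR (Ses (C := C)) E1.{w} 𝒲) : GorClass 𝒴 ⊆ GR (Ses (C := C)) E1.{w} 𝒲 := by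
  have key : Cyc 𝒴 ⊆ GR (Ses (C := C)) E1.{w} 𝒲 := by
    apply GR_of (absAx 𝒲 hs)
    rintro M ⟨X, d, h, n, ⟨i⟩⟩
    refine ⟨fun V hV => ⟨E1_iso i (Iso.refl _) (cyc_E1 h (h1 hV)
      (fun Y hY => ((rgood_GR Y (h2 hY)).1 V hV).1) n), E1_iso (Iso.refl _) i (cyc_E1' h (h1 hV)
      (fun Y hY => ((rgood_GR Y (h2 hY)).1 V hV).2) n)⟩, ?_⟩
    obtain ⟨n, rfl⟩ : ∃ m, n = m + 1 := ⟨n - 1, by ring⟩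
    exact ⟨X n, h2 (h.mem n), cokernel (d n), ⟨X, d, h, n, ⟨Iso.refl _⟩⟩,
      Ses.congr ⟨_, _, _, ta_ses h n⟩ i (Iso.refl _) (Iso.refl _)⟩
  rintro M ⟨X, d, h, hi⟩
  exact key ⟨X, d, h, 0, hi⟩

theorem gor_sub_L {𝒲 𝒴 : Set C} (hs : SumClosed 𝒲) (h1 : 𝒲 ⊆ 𝒴)
    (h2 : 𝒴 ⊆ GR (fun A B D : C => Ses D B A) (fun A B => E1.{w} B A) 𝒲) :
    GorClass 𝒴 ⊆ GR (fun A B D : C => Ses D B A) (fun A B => E1.{w} B A) 𝒲 := by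
  have key : Cyc 𝒴 ⊆ GR (fun A B D : C => Ses D B A) (fun A B => E1.{w} B A) 𝒲 := by
    apply GR_of (absAx' 𝒲 hs)
    rintro M ⟨X, d, h, n, ⟨i⟩⟩
    refine ⟨fun V hV => ⟨E1_iso (Iso.refl _) i (cyc_E1' h (h1 hV)
      (fun Y hY => ((rgood_GR Y (h2 hY)).1 V hV).1) n), E1_iso i (Iso.refl _) (cyc_E1 h (h1 hV)
      (fun Y hY => ((rgood_GR Y (h2 hY)).1 V hV).2) n)⟩, ?_⟩
    exact ⟨X n, h2 (h.mem n), cokernel (d (n + 1)), ⟨X, d, h, n + 1, ⟨Iso.refl _⟩⟩,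
      Ses.congr ⟨_, _, _, ta_ses h n⟩ (Iso.refl _) (Iso.refl _) i⟩
  rintro M ⟨X, d, h, hi⟩
  exact key ⟨X, d, h, 0, hi⟩

theorem splice {𝒲 : Set C} (Z : ℤ → C) (hE : ∀ n, ∀ V ∈ 𝒲, E1.{w} (Z n) V ∧ E1.{w} V (Z n))
    (hZ : ∀ n, ∃ V ∈ 𝒲, Ses (Z (n + 1)) V (Z n)) : Z 0 ∈ GorClass 𝒲 := by
  choose V hV f g w hS using hZ
  have hm : ∀ n, Mono (f n) := fun n => (hS n).mono_f
  have he : ∀ n, Epi (g n) := fun n => (hS n).epi_g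
  have hlift : ∀ n {T : C} (φ : T ⟶ V n), φ ≫ g n = 0 → ∃ ψ, ψ ≫ f n = φ := fun n T φ hφ =>
    ⟨(hS n).fIsKernel.lift (KernelFork.ofι φ hφ),
      (hS n).fIsKernel.fac (KernelFork.ofι φ hφ) WalkingParallelPair.zero⟩
  have hdesc : ∀ n {T : C} (φ : V n ⟶ T), f n ≫ φ = 0 → ∃ ψ, g n ≫ ψ = φ := fun n T φ hφ =>
    ⟨(hS n).gIsCokernel.desc (CokernelCofork.ofπ φ hφ),
      (hS n).gIsCokernel.fac (CokernelCofork.ofπ φ hφ) WalkingParallelPair.one⟩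
  refine ⟨V, fun n => g (n + 1) ≫ f n, ⟨hV, fun n => ?_, fun n => ?_, ?_, ?_⟩, ?_⟩
  · simp [reassoc_of% (w (n + 1))]
  · rw [ShortComplex.exact_iff_exact_up_to_refinements]
    intro A x hx
    dsimp at x hx ⊢
    rw [← Category.assoc] at hx
    obtain ⟨ψ, hψ⟩ := hlift _ x (zero_of_comp_mono _ hx)
    obtain ⟨A', π, hπ, y, hy⟩ := surjective_up_to_refinements_of_epi (g (n + 1 + 1)) ψ
    exact ⟨A', π, hπ, y, by rw [← hψ, reassoc_of% hy]⟩
  · intro W hW n φ hφ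
    rw [← Category.assoc] at hφ
    obtain ⟨ψ, hψ⟩ := hlift _ φ (zero_of_comp_mono _ hφ)
    obtain ⟨χ, hχ⟩ := lift_of_E1 (hS (n + 1 + 1)) (hE _ W hW).2 ψ
    dsimp at hχ
    exact ⟨χ, by rw [← hψ, ← hχ, Category.assoc]⟩
  · intro W hW n φ hφ
    rw [Category.assoc] at hφ
    obtain ⟨ψ, hψ⟩ := hdesc _ φ (zero_of_epi_comp _ hφ)
    obtain ⟨χ, hχ⟩ := extend_of_E1 (hS n) (hE _ W hW).1 ψ
    dsimp at hχ
    exact ⟨χ, by rw [← hψ, ← hχ, Category.assoc]⟩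
  · exact ⟨(cokernelEpiComp (g (0 + 1)) (f 0)) ≪≫
      (cokernelIsCokernel (f 0)).coconePointUniqueUpToIso (hS 0).gIsCokernel⟩

theorem mem_gor {𝒲 : Set C} {M : C} (hR : M ∈ GR (Ses (C := C)) E1.{w} 𝒲)
    (hL : M ∈ GR (fun A B D : C => Ses D B A) (fun A B => E1.{w} B A) 𝒲) : M ∈ GorClass 𝒲 := by
  obtain ⟨Z, hZ0, hZE, hZ⟩ := GR_seq hR
  obtain ⟨Y, hY0, hYE, hY⟩ := GR_seq hL
  let F : ℤ → C := fun n => match n with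
    | Int.ofNat k => Y k
    | Int.negSucc k => Z (k + 1)
  have : F 0 ∈ GorClass 𝒲 := by
    refine splice.{w} F ?_ ?_
    · rintro (k | k) V hV
      · exact ⟨(hYE k V hV).2, (hYE k V hV).1⟩
      · exact hZE (k + 1) V hV
    · rintro (k | _ | k)
      · exact hY k
      · have := hZ 0
        rw [hZ0, ← hY0] at this
        exact this
      · exact hZ (k + 1)
  have h0 : F 0 = M := hY0
  rwa [h0] at this

theorem sub_gor {𝒲 𝒴 : Set C} (hs : SumClosed 𝒲) (h : 𝒲 ⊆ 𝒴) : 𝒲 ⊆ GorClass 𝒴 := by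
  intro V hV
  have hsp : (ShortComplex.mk (biprod.inl : V ⟶ V ⊞ V) biprod.snd (by simp)).ShortExact :=
    (ShortComplex.Splitting.ofHasBinaryBiproduct V V).shortExact
  refine ⟨fun _ => V ⊞ V, fun _ => biprod.snd ≫ biprod.inl,
    ⟨fun _ => h (hs hV hV), fun _ => by simp, fun n => ?_, fun W hW n φ hφ => ?_,
      fun W hW n φ hφ => ?_⟩, ?_⟩
  · rw [ShortComplex.exact_iff_exact_up_to_refinements]
    intro A x hx
    dsimp at x hx ⊢
    have hx' : x ≫ biprod.snd = 0 := by simpa using hx =≫ biprod.fst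
    refine ⟨A, 𝟙 _, inferInstance, x ≫ biprod.fst ≫ biprod.inr, ?_⟩
    apply biprod.hom_ext <;> simp [hx']
  · have hx' : φ ≫ biprod.snd = 0 := by simpa using hφ =≫ biprod.fst
    refine ⟨φ ≫ biprod.fst ≫ biprod.inr, ?_⟩
    apply biprod.hom_ext <;> simp [hx']
  · have hx' : biprod.inl ≫ φ = 0 := by simpa using biprod.inr ≫= hφ
    refine ⟨biprod.fst ≫ biprod.inr ≫ φ, ?_⟩
    apply biprod.hom_ext' <;> simp [hx']
  · exact ⟨(cokernelEpiComp _ _) ≪≫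
      (cokernelIsCokernel _).coconePointUniqueUpToIso hsp.gIsCokernel⟩

end ExtLemmas

variable [EnoughProjectives C] [EnoughInjectives C] [HasExt.{w} C]

/-- Theorem 3.9: if `𝒳` is closed under extensions and `𝒲` is both an
injective cogenerator and a projective generator for `𝒳`, then `G^n(𝒳) ⊆ G(𝒲)` for each
`n ≥ 1`. -/
theorem stmt_14 (𝒲 𝒳 : Set C)
    (h𝒲iso : IsoClosed 𝒲) (h𝒲sum : SumClosed 𝒲)
    (h𝒳iso : IsoClosed 𝒳) (h𝒳sum : SumClosed 𝒳)
    (hX : ExtensionClosed 𝒳)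
    (hcog : IsInjCogen 𝒲 𝒳) (hgen : IsProjGen 𝒲 𝒳)
    (n : ℕ) (hn : 1 ≤ n) :
    GorIter 𝒳 n ⊆ GorClass 𝒲 := by
  have key : ∀ n, 𝒲 ⊆ GorIter 𝒳 n ∧ GorIter 𝒳 n ⊆ GR (Ses (C := C)) E1.{w} 𝒲 ∧
      GorIter 𝒳 n ⊆ GR (fun A B D : C => Ses D B A) (fun A B => E1.{w} B A) 𝒲 := by
    intro n
    induction n with
    | zero =>
      refine ⟨hcog.1.1, fun M hM => ⟨𝒳, ?_, hM⟩, fun M hM => ⟨𝒳, ?_, hM⟩⟩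
      · intro N hN
        refine ⟨fun V hV => ⟨hcog.2 N hN V hV 1 le_rfl, hgen.2 V hV N hN 1 le_rfl⟩, ?_⟩
        obtain ⟨W, X', i, p, w, hW, hX', hs⟩ := hcog.1.2 N hN
        exact ⟨W, hW, X', hX', i, p, w, hs⟩
      · intro N hN
        refine ⟨fun V hV => ⟨hgen.2 V hV N hN 1 le_rfl, hcog.2 N hN V hV 1 le_rfl⟩, ?_⟩
        obtain ⟨X', W, i, p, w, hW, hX', hs⟩ := hgen.1.2 N hN
        exact ⟨W, hW, X', hX', i, p, w, hs⟩
    | succ n ih =>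
      exact ⟨sub_gor h𝒲sum ih.1, gor_sub_R h𝒲sum ih.1 ih.2.1, gor_sub_L h𝒲sum ih.1 ih.2.2⟩
  intro M hM
  exact mem_gor.{w} ((key n).2.1 hM) ((key n).2.2 hM)
end

section
/- If W is a subcategory of A with W ⊥ W, then G^n(W) = G(W) for each n ≥ 1; that is, the iterated Gorenstein subcategories stabilize after one step. -/
open CategoryTheory CategoryTheory.Limits CategoryTheory.Abelian

universe w v u

variable {C : Type u} [Category.{v} C] [Abelian C]

namespace GorAux

/-- short exact sequences, as a proposition -/
structure SES {A B D : C} (f : A ⟶ B) (g : B ⟶ D) : Prop where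
  w : f ≫ g = 0
  mono : Mono f
  epi : Epi g
  exact : (ShortComplex.mk f g w).Exact

theorem SES.shortExact {A B D : C} {f : A ⟶ B} {g : B ⟶ D} (h : SES f g) :
    (ShortComplex.mk f g h.w).ShortExact :=
  have := h.mono
  have := h.epi
  { exact := h.exact, mono_f := h.mono, epi_g := h.epi }

theorem SES.lift {A B D : C} {f : A ⟶ B} {g : B ⟶ D} (h : SES f g) {X : C} (x : X ⟶ B)
    (hx : x ≫ g = 0) : ∃ y : X ⟶ A, y ≫ f = x := by
  have := h.mono
  obtain ⟨y, hy⟩ := ShortComplex.Exact.lift' h.exact x hx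
  exact ⟨y, hy⟩

theorem SES.desc {A B D : C} {f : A ⟶ B} {g : B ⟶ D} (h : SES f g) {X : C} (x : B ⟶ X)
    (hx : f ≫ x = 0) : ∃ y : D ⟶ X, g ≫ y = x := by
  have := h.epi
  obtain ⟨y, hy⟩ := ShortComplex.Exact.desc' h.exact x hx
  exact ⟨y, hy⟩

theorem SES.of {A B D : C} {f : A ⟶ B} {g : B ⟶ D} (w : f ≫ g = 0) (hf : Mono f) (hg : Epi g)
    (h : ∀ (X : C) (x : X ⟶ B), x ≫ g = 0 →
      ∃ (X' : C) (π : X' ⟶ X) (_ : Epi π) (y : X' ⟶ A), π ≫ x = y ≫ f) : SES f g :=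
  ⟨w, hf, hg, by
    rw [ShortComplex.exact_iff_exact_up_to_refinements]
    intro X x hx
    exact h X x hx⟩

theorem SES.of_iso_left {A A' B D : C} {f : A ⟶ B} {g : B ⟶ D} (h : SES f g) (e : A' ≅ A) :
    SES (e.hom ≫ f) g := by
  have := h.mono
  refine SES.of (by simp [h.w]) inferInstance h.epi ?_
  intro X x hx
  obtain ⟨y, hy⟩ := h.lift x hx
  exact ⟨X, 𝟙 X, inferInstance, y ≫ e.inv, by simp [hy]⟩

theorem SES.of_iso_right {A B D D' : C} {f : A ⟶ B} {g : B ⟶ D} (h : SES f g) (e : D ≅ D') :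
    SES f (g ≫ e.hom) := by
  have := h.epi
  refine SES.of (by simp [reassoc_of% h.w]) h.mono inferInstance ?_
  intro X x hx
  have hx' : x ≫ g = 0 := by
    rw [← cancel_mono e.hom]; simpa using hx
  obtain ⟨y, hy⟩ := h.lift x hx'
  exact ⟨X, 𝟙 X, inferInstance, y, by simp [hy]⟩

theorem ses_coker {A B : C} (f : A ⟶ B) [Mono f] : SES f (cokernel.π f) :=
  ⟨cokernel.condition f, inferInstance, inferInstance,
    ShortComplex.exact_of_g_is_cokernel _ (cokernelIsCokernel f)⟩

theorem ses_ker {A B : C} (f : A ⟶ B) [Epi f] : SES (kernel.ι f) f :=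
  ⟨kernel.condition f, inferInstance, inferInstance,
    ShortComplex.exact_of_f_is_kernel _ (kernelIsKernel f)⟩

/-- cokernel of a composite of monomorphisms -/
theorem comp_mono {A B D P Q : C} {f : A ⟶ B} {p : B ⟶ P} {g : B ⟶ D} {q : D ⟶ Q}
    (h₁ : SES f p) (h₂ : SES g q) :
    ∃ (N : C) (r : D ⟶ N) (u : P ⟶ N) (v : N ⟶ Q), SES (f ≫ g) r ∧ SES u v := by
  have := h₁.mono
  have := h₁.epi
  have := h₂.mono
  have := h₂.epi
  have hr := ses_coker (f ≫ g)
  obtain ⟨u, hu⟩ := h₁.desc (g ≫ cokernel.π (f ≫ g)) (by rw [← Category.assoc, hr.w])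
  obtain ⟨v, hv⟩ := hr.desc q (by rw [Category.assoc, h₂.w, comp_zero])
  refine ⟨cokernel (f ≫ g), cokernel.π (f ≫ g), u, v, hr, SES.of ?_ ?_ ?_ ?_⟩
  · rw [← cancel_epi p, reassoc_of% hu, hv, h₂.w, comp_zero]
  · apply Preadditive.mono_of_cancel_zero
    intro X x hx
    obtain ⟨X', π, _, b, hb⟩ := surjective_up_to_refinements_of_epi p x
    obtain ⟨a, ha⟩ := hr.lift (b ≫ g) (by
      rw [Category.assoc, ← hu, ← reassoc_of% hb, hx, comp_zero])
    have hab : a ≫ f = b := by rw [← cancel_mono g]; simpa using ha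
    rw [← cancel_epi π, hb, ← hab, Category.assoc, h₁.w, comp_zero, comp_zero]
  · have : Epi (cokernel.π (f ≫ g) ≫ v) := by rw [hv]; infer_instance
    exact epi_of_epi (cokernel.π (f ≫ g)) v
  · intro X x hx
    obtain ⟨X', π, _, b, hb⟩ := surjective_up_to_refinements_of_epi (cokernel.π (f ≫ g)) x
    obtain ⟨a, ha⟩ := h₂.lift b (by rw [← hv, ← reassoc_of% hb, hx, comp_zero])
    exact ⟨X', π, inferInstance, a ≫ p, by rw [hb, Category.assoc, hu, reassoc_of% ha]⟩

/-- kernel of a composite of epimorphisms -/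
theorem comp_epi {A B D P Q : C} {i : P ⟶ A} {f : A ⟶ B} {j : Q ⟶ B} {g : B ⟶ D}
    (h₁ : SES i f) (h₂ : SES j g) :
    ∃ (N : C) (k : N ⟶ A) (u : P ⟶ N) (v : N ⟶ Q), SES k (f ≫ g) ∧ SES u v := by
  have := h₁.mono
  have := h₁.epi
  have := h₂.mono
  have := h₂.epi
  have hr := ses_ker (f ≫ g)
  obtain ⟨u, hu⟩ := hr.lift i (by rw [reassoc_of% h₁.w, zero_comp])
  obtain ⟨v, hv⟩ := h₂.lift (kernel.ι (f ≫ g) ≫ f) (by rw [Category.assoc, hr.w])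
  refine ⟨kernel (f ≫ g), kernel.ι (f ≫ g), u, v, hr, SES.of ?_ ?_ ?_ ?_⟩
  · rw [← cancel_mono j, Category.assoc, hv, reassoc_of% hu, h₁.w, zero_comp]
  · have : Mono (u ≫ kernel.ι (f ≫ g)) := by rw [hu]; infer_instance
    exact mono_of_mono u (kernel.ι (f ≫ g))
  · rw [epi_iff_surjective_up_to_refinements]
    intro X x
    obtain ⟨X', π, _, a, ha⟩ := surjective_up_to_refinements_of_epi f (x ≫ j)
    obtain ⟨n, hn⟩ := hr.lift a (by
      rw [← reassoc_of% ha, h₂.w, comp_zero, comp_zero])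
    refine ⟨X', π, inferInstance, n, ?_⟩
    rw [← cancel_mono j, Category.assoc, Category.assoc, hv, reassoc_of% hn, ha]
  · intro X x hx
    obtain ⟨a, ha⟩ := h₁.lift (x ≫ kernel.ι (f ≫ g)) (by
      rw [Category.assoc, ← hv, reassoc_of% hx, zero_comp])
    refine ⟨X, 𝟙 X, inferInstance, a, ?_⟩
    rw [← cancel_mono (kernel.ι (f ≫ g)), Category.id_comp, Category.assoc, hu, ha]

theorem horse_mono {A B D WA A' WD D' : C} {f : A ⟶ B} {g : B ⟶ D} {i : A ⟶ WA} {p : WA ⟶ A'}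
    {j : D ⟶ WD} {q : WD ⟶ D'} (h : SES f g) (hA : SES i p) (hD : SES j q)
    (t : B ⟶ WA) (ht : f ≫ t = i) :
    ∃ (N : C) (a : B ⟶ WA ⊞ WD) (r : WA ⊞ WD ⟶ N) (u : A' ⟶ N) (v : N ⟶ D'),
      SES a r ∧ SES u v := by
  have := h.epi
  have := hA.mono
  have := hA.epi
  have := hD.mono
  have := hD.epi
  obtain ⟨c, hc⟩ := h.desc (t ≫ p) (by rw [reassoc_of% ht, hA.w])
  have h₁ : SES (biprod.lift t g) (biprod.desc p (-c)) := by
    refine SES.of ?_ ?_ ?_ ?_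
    · simp [hc]
    · apply Preadditive.mono_of_cancel_zero
      intro X x hx
      have hx1 : x ≫ t = 0 := by
        have := congrArg (fun z => z ≫ biprod.fst) hx; simpa using this
      have hx2 : x ≫ g = 0 := by
        have := congrArg (fun z => z ≫ biprod.snd) hx; simpa using this
      obtain ⟨y, hy⟩ := h.lift x hx2
      have : y = 0 := by
        rw [← cancel_mono i, ← ht, reassoc_of% hy, hx1, zero_comp]
      rw [← hy, this, zero_comp]
    · have : Epi (biprod.inl ≫ biprod.desc p (-c)) := by
        rw [biprod.inl_desc]; infer_instance
      exact epi_of_epi biprod.inl _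
    · intro X x hx
      obtain ⟨X', π, _, b, hb⟩ := surjective_up_to_refinements_of_epi g (x ≫ biprod.snd)
      have hx' : (x ≫ biprod.fst) ≫ p = (x ≫ biprod.snd) ≫ c := by
        have : x ≫ biprod.desc p (-c) = (x ≫ biprod.fst) ≫ p - (x ≫ biprod.snd) ≫ c := by
          rw [biprod.desc_eq]; simp [sub_eq_add_neg]
        rw [this] at hx
        exact sub_eq_zero.mp hx
      obtain ⟨a, ha⟩ := hA.lift (π ≫ x ≫ biprod.fst - b ≫ t) (by
        rw [Preadditive.sub_comp, Category.assoc, hx', Category.assoc b t p,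
          ← hc, Category.assoc x, reassoc_of% hb, sub_self])
      refine ⟨X', π, inferInstance, b + a ≫ f, ?_⟩
      apply biprod.hom_ext
      · simp [ht, ha]
      · simp [hb, h.w]
  have h₂ : SES (biprod.map (𝟙 WA) j) (biprod.snd ≫ q) := by
    refine SES.of ?_ ?_ ?_ ?_
    · simp [hD.w]
    · infer_instance
    · infer_instance
    · intro X x hx
      obtain ⟨y, hy⟩ := hD.lift (x ≫ biprod.snd) (by simpa using hx)
      refine ⟨X, 𝟙 X, inferInstance, biprod.lift (x ≫ biprod.fst) y, ?_⟩
      apply biprod.hom_ext <;> simp [hy]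
  obtain ⟨N, r, u, v, h₃, h₄⟩ := comp_mono h₁ h₂
  exact ⟨N, _, r, u, v, h₃, h₄⟩

theorem horse_epi {A B D WA A' WD D' : C} {f : A ⟶ B} {g : B ⟶ D} {i : A' ⟶ WA} {p : WA ⟶ A}
    {j : D' ⟶ WD} {q : WD ⟶ D} (h : SES f g) (hA : SES i p) (hD : SES j q)
    (t : WD ⟶ B) (ht : t ≫ g = q) :
    ∃ (N : C) (k : N ⟶ WA ⊞ WD) (a : WA ⊞ WD ⟶ B) (u : A' ⟶ N) (v : N ⟶ D'),
      SES k a ∧ SES u v := by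
  have := h.mono
  have := h.epi
  have := hA.mono
  have := hA.epi
  have := hD.mono
  have := hD.epi
  obtain ⟨c, hc⟩ := h.lift (j ≫ t) (by rw [Category.assoc, ht, hD.w])
  have h₂ : SES (biprod.lift (-c) j) (biprod.desc f t) := by
    refine SES.of ?_ ?_ ?_ ?_
    · simp [hc]
    · have : Mono (biprod.lift (-c) j ≫ biprod.snd) := by
        rw [biprod.lift_snd]; infer_instance
      exact mono_of_mono _ biprod.snd
    · rw [epi_iff_surjective_up_to_refinements]
      intro X x
      obtain ⟨X', π, _, b, hb⟩ := surjective_up_to_refinements_of_epi q (x ≫ g)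
      obtain ⟨a, ha⟩ := h.lift (π ≫ x - b ≫ t) (by
        rw [Preadditive.sub_comp, Category.assoc, Category.assoc, ht, hb, sub_self])
      refine ⟨X', π, inferInstance, biprod.lift a b, ?_⟩
      simp [ha]
    · intro X x hx
      have hx' : (x ≫ biprod.fst) ≫ f + (x ≫ biprod.snd) ≫ t = 0 := by
        rw [biprod.desc_eq] at hx; simpa using hx
      have hx2 : (x ≫ biprod.snd) ≫ q = 0 := by
        have := congrArg (fun z => z ≫ g) hx'
        simpa [h.w, ht] using this
      obtain ⟨z, hz⟩ := hD.lift _ hx2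
      refine ⟨X, 𝟙 X, inferInstance, z, ?_⟩
      apply biprod.hom_ext
      · rw [← cancel_mono f]
        rw [← hz, Category.assoc z j t, ← hc] at hx'
        simpa using eq_neg_of_add_eq_zero_left hx'
      · simp [hz]
  have h₁ : SES (i ≫ biprod.inl) (biprod.map p (𝟙 WD)) := by
    refine SES.of ?_ ?_ ?_ ?_
    · simp [reassoc_of% hA.w]
    · infer_instance
    · infer_instance
    · intro X x hx
      obtain ⟨y, hy⟩ := hA.lift (x ≫ biprod.fst) (by
        have := congrArg (fun z => z ≫ biprod.fst) hx; simpa using this)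
      have h2 : x ≫ biprod.snd = 0 := by
        have := congrArg (fun z => z ≫ biprod.snd) hx; simpa using this
      refine ⟨X, 𝟙 X, inferInstance, y, ?_⟩
      apply biprod.hom_ext
      · simp [hy]
      · simp [h2]
  obtain ⟨N, k, u, v, h₃, h₄⟩ := comp_epi h₁ h₂
  exact ⟨N, k, _, u, v, h₃, h₄⟩

section E

variable [HasExt.{w} C]

/-- vanishing of the first Ext group -/
def E1 (A B : C) : Prop := ∀ x : Ext.{w} A B 1, x = 0

theorem E1.extend {A B D V : C} {f : A ⟶ B} {g : B ⟶ D} (h : SES f g) (hV : E1.{w} D V)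
    (φ : A ⟶ V) : ∃ ψ : B ⟶ V, f ≫ ψ = φ := by
  obtain ⟨x, hx⟩ := Ext.contravariant_sequence_exact₁ h.shortExact V (Ext.mk₀ φ) (n₁ := 1)
    (by rfl) (hV _)
  refine ⟨Ext.homEquiv₀ x, ?_⟩
  apply Ext.mk₀_bijective.{w} A V |>.1
  rw [← Ext.mk₀_comp_mk₀, Ext.mk₀_homEquiv₀_apply]
  exact hx

theorem E1.lift {A B D V : C} {f : A ⟶ B} {g : B ⟶ D} (h : SES f g) (hV : E1.{w} V A)
    (φ : V ⟶ D) : ∃ ψ : V ⟶ B, ψ ≫ g = φ := by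
  obtain ⟨x, hx⟩ := Ext.covariant_sequence_exact₃ V h.shortExact (Ext.mk₀ φ) (n₁ := 1)
    (by rfl) (hV _)
  refine ⟨Ext.homEquiv₀ x, ?_⟩
  apply Ext.mk₀_bijective.{w} V D |>.1
  rw [← Ext.mk₀_comp_mk₀, Ext.mk₀_homEquiv₀_apply]
  exact hx

theorem E1.of_extend {A B D V : C} {f : A ⟶ B} {g : B ⟶ D} (h : SES f g) (hB : E1.{w} B V)
    (hx : ∀ φ : A ⟶ V, ∃ ψ : B ⟶ V, f ≫ ψ = φ) : E1.{w} D V := by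
  intro x
  obtain ⟨y, rfl⟩ := Ext.contravariant_sequence_exact₃ h.shortExact V x (hB _) (n₀ := 0) (by rfl)
  obtain ⟨φ, rfl⟩ := (Ext.mk₀_bijective.{w} A V).2 y
  obtain ⟨ψ, rfl⟩ := hx φ
  rw [← Ext.mk₀_comp_mk₀]
  exact h.shortExact.extClass_comp_assoc _

theorem E1.of_lift {A B D V : C} {f : A ⟶ B} {g : B ⟶ D} (h : SES f g) (hB : E1.{w} V B)
    (hx : ∀ φ : V ⟶ D, ∃ ψ : V ⟶ B, ψ ≫ g = φ) : E1.{w} V A := by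
  intro x
  obtain ⟨y, rfl⟩ := Ext.covariant_sequence_exact₁ V h.shortExact x (hB _) (n₀ := 0) (by rfl)
  obtain ⟨φ, rfl⟩ := (Ext.mk₀_bijective.{w} V D).2 y
  obtain ⟨ψ, rfl⟩ := hx φ
  rw [← Ext.mk₀_comp_mk₀, Ext.comp_assoc_of_second_deg_zero]
  have := h.shortExact.comp_extClass
  dsimp at this
  rw [this, Ext.comp_zero]

theorem E1.mid_left {A B D V : C} {f : A ⟶ B} {g : B ⟶ D} (h : SES f g) (hA : E1.{w} A V)
    (hD : E1.{w} D V) : E1.{w} B V := by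
  intro x
  obtain ⟨y, rfl⟩ := Ext.contravariant_sequence_exact₂ h.shortExact V x (hA _)
  rw [hD y, Ext.comp_zero]

theorem E1.mid_right {A B D V : C} {f : A ⟶ B} {g : B ⟶ D} (h : SES f g) (hA : E1.{w} V A)
    (hD : E1.{w} V D) : E1.{w} V B := by
  intro x
  obtain ⟨y, rfl⟩ := Ext.covariant_sequence_exact₂ V h.shortExact x (hD _)
  rw [hA y, Ext.zero_comp]

end E

end GorAux

namespace GorAux

/-- the differential with free indices -/
def dd (X : ℤ → C) (d : ∀ n : ℤ, X (n + 1) ⟶ X n) (i j : ℤ) (h : i = j + 1) : X i ⟶ X j :=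
  eqToHom (congrArg X h) ≫ d j

theorem shift_ta {𝒳 : Set C} {X : ℤ → C} {d : ∀ n : ℤ, X (n + 1) ⟶ X n}
    (h : IsTotallyAcyclic 𝒳 X d) (k : ℤ) :
    IsTotallyAcyclic 𝒳 (fun n => X (n + k))
      (fun n => dd X d (n + 1 + k) (n + k) (by ring)) := by
  have hw : ∀ (a b c : ℤ) (h₁ : a = b + 1) (h₂ : b = c + 1),
      dd X d a b h₁ ≫ dd X d b c h₂ = 0 := by
    intro a b c h₁ h₂
    subst h₂
    subst h₁
    simpa [dd] using h.w c
  have hex : ∀ (a b c : ℤ) (h₁ : a = b + 1) (h₂ : b = c + 1),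
      (ShortComplex.mk _ _ (hw a b c h₁ h₂)).Exact := by
    intro a b c h₁ h₂
    subst h₂
    subst h₁
    simpa [dd] using h.exact c
  have h1 : ∀ (a b c : ℤ) (h₁ : a = b + 1) (h₂ : b = c + 1), ∀ W ∈ 𝒳, ∀ φ : W ⟶ X b,
      φ ≫ dd X d b c h₂ = 0 → ∃ ψ : W ⟶ X a, ψ ≫ dd X d a b h₁ = φ := by
    intro a b c h₁ h₂ W hW
    subst h₂
    subst h₁
    simpa [dd] using h.homExact W hW c
  have h2 : ∀ (a b c : ℤ) (h₁ : a = b + 1) (h₂ : b = c + 1), ∀ W ∈ 𝒳, ∀ φ : X b ⟶ W,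
      dd X d a b h₁ ≫ φ = 0 → ∃ ψ : X c ⟶ W, dd X d b c h₂ ≫ ψ = φ := by
    intro a b c h₁ h₂ W hW
    subst h₂
    subst h₁
    simpa [dd] using h.homExact' W hW c
  exact ⟨fun n => h.mem _, fun n => hw _ _ _ _ _, fun n => hex _ _ _ _ _,
    fun W hW n => h1 _ _ _ _ _ W hW, fun W hW n => h2 _ _ _ _ _ W hW⟩

theorem coker_mem {𝒳 : Set C} {X : ℤ → C} {d : ∀ n : ℤ, X (n + 1) ⟶ X n}
    (h : IsTotallyAcyclic 𝒳 X d) (k : ℤ) : cokernel (d k) ∈ GorClass 𝒳 := by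
  refine ⟨_, _, shift_ta h k, ?_⟩
  have : ∀ (a b : ℤ) (hab : a = b + 1) (hb : b = k),
      Nonempty (cokernel (dd X d a b hab) ≅ cokernel (d k)) := by
    intro a b hab hb
    subst hb
    subst hab
    refine ⟨cokernelIsoOfEq ?_⟩
    simp [dd]
  exact this _ _ _ (by simp)

/-- the property of short exact sequences being Hom-exact in both variables -/
structure HSES (𝒳 : Set C) {A B D : C} (f : A ⟶ B) (g : B ⟶ D) : Prop extends SES f g where
  ext : ∀ V ∈ 𝒳, ∀ φ : A ⟶ V, ∃ ψ : B ⟶ V, f ≫ ψ = φ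
  lif : ∀ V ∈ 𝒳, ∀ φ : V ⟶ D, ∃ ψ : V ⟶ B, ψ ≫ g = φ

theorem hses_ta {𝒳 : Set C} {X : ℤ → C} {d : ∀ n : ℤ, X (n + 1) ⟶ X n}
    (h : IsTotallyAcyclic 𝒳 X d) (n : ℤ) :
    HSES 𝒳 (cokernel.desc (d (n + 1)) (d n) (h.w n)) (cokernel.π (d n)) := by
  have hm : ∀ n, Mono (cokernel.desc (d (n + 1)) (d n) (h.w n)) := fun n =>
    (h.exact n).mono_cokernelDesc
  refine { SES.of ?_ (hm n) inferInstance ?_ with ext := ?_, lif := ?_ }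
  · rw [← cancel_epi (cokernel.π (d (n + 1)))]
    simp
  · intro Y x hx
    have he := ShortComplex.exact_of_g_is_cokernel
      (ShortComplex.mk (d n) (cokernel.π (d n)) (cokernel.condition _))
      (cokernelIsCokernel (d n))
    obtain ⟨Y', π, hπ, y, hy⟩ := he.exact_up_to_refinements x hx
    exact ⟨Y', π, hπ, y ≫ cokernel.π _, by simpa using hy⟩
  · intro V hV φ
    obtain ⟨ψ, hψ⟩ := h.homExact' V hV n (cokernel.π _ ≫ φ) (by simp)
    refine ⟨ψ, ?_⟩
    rw [← cancel_epi (cokernel.π (d (n + 1)))]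
    simpa using hψ
  · intro V hV φ
    obtain ⟨k, rfl⟩ : ∃ k : ℤ, n = k + 1 + 1 := ⟨n - 2, by ring⟩
    obtain ⟨ψ, hψ⟩ := h.homExact V hV k
      (φ ≫ cokernel.desc (d (k + 1 + 1)) (d (k + 1)) (h.w (k + 1))) (by
        have : cokernel.desc (d (k + 1 + 1)) (d (k + 1)) (h.w (k + 1)) ≫ d k = 0 := by
          rw [← cancel_epi (cokernel.π (d (k + 1 + 1)))]
          simp [h.w]
        rw [Category.assoc, this, comp_zero])
    refine ⟨ψ, ?_⟩
    have := hm (k + 1)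
    rw [← cancel_mono (cokernel.desc (d (k + 1 + 1)) (d (k + 1)) (h.w (k + 1)))]
    simpa using hψ

theorem gor_right {𝒳 : Set C} {M : C} (hM : M ∈ GorClass 𝒳) :
    ∃ (G M' : C) (f : M ⟶ G) (g : G ⟶ M'), G ∈ 𝒳 ∧ M' ∈ GorClass 𝒳 ∧ HSES 𝒳 f g := by
  obtain ⟨X, d, h, ⟨e⟩⟩ := hM
  have key : ∀ m : ℤ, Nonempty (cokernel (d m) ≅ M) →
      ∃ n : ℤ, Nonempty (cokernel (d (n + 1)) ≅ M) := fun m hm =>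
    ⟨m - 1, by rw [sub_add_cancel]; exact hm⟩
  obtain ⟨n, ⟨e⟩⟩ := key 0 ⟨e⟩
  have hs := hses_ta h n
  refine ⟨X n, cokernel (d n), _, _, h.mem n, coker_mem h n,
    { hs.toSES.of_iso_left e.symm with ext := ?_, lif := hs.lif }⟩
  intro V hV φ
  obtain ⟨ψ, hψ⟩ := hs.ext V hV (e.hom ≫ φ)
  exact ⟨ψ, by rw [Category.assoc, hψ]; simp⟩

theorem gor_left {𝒳 : Set C} {M : C} (hM : M ∈ GorClass 𝒳) :
    ∃ (M' G : C) (f : M' ⟶ G) (g : G ⟶ M), G ∈ 𝒳 ∧ M' ∈ GorClass 𝒳 ∧ HSES 𝒳 f g := by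
  obtain ⟨X, d, h, ⟨e⟩⟩ := hM
  have hs := hses_ta h 0
  refine ⟨_, X 0, _, _, h.mem 0, coker_mem h (0 + 1),
    { hs.toSES.of_iso_right e with ext := hs.ext, lif := ?_ }⟩
  intro V hV φ
  obtain ⟨ψ, hψ⟩ := hs.lif V hV (φ ≫ e.inv)
  exact ⟨ψ, by rw [reassoc_of% hψ]; simp⟩

theorem gor_iso {𝒳 : Set C} : IsoClosed (GorClass 𝒳) := by
  rintro A B e ⟨X, d, h, ⟨e'⟩⟩
  exact ⟨X, d, h, ⟨e' ≪≫ e⟩⟩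

/-- any sum-closed class is contained in its Gorenstein class -/
theorem le_gor {𝒳 : Set C} (hs : SumClosed 𝒳) : 𝒳 ⊆ GorClass 𝒳 := by
  intro M hM
  refine ⟨fun _ => M ⊞ M, fun _ => biprod.snd ≫ biprod.inl,
    ⟨fun _ => hs hM hM, fun _ => by simp, fun _ => ?_, ?_, ?_⟩, ⟨?_⟩⟩
  · rw [ShortComplex.exact_iff_exact_up_to_refinements]
    intro Y (x : Y ⟶ M ⊞ M) hx
    have hx' : x ≫ biprod.snd = 0 := by
      have := congrArg (fun z => z ≫ biprod.fst) hx
      simpa using this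
    refine ⟨Y, 𝟙 Y, inferInstance, (x ≫ biprod.fst) ≫ biprod.inr, ?_⟩
    dsimp
    apply biprod.hom_ext <;> simp [hx']
  · intro W hW n (x : W ⟶ M ⊞ M) hx
    have hx' : x ≫ biprod.snd = 0 := by
      have := congrArg (fun z => z ≫ biprod.fst) hx
      simpa using this
    refine ⟨(x ≫ biprod.fst) ≫ biprod.inr, ?_⟩
    apply biprod.hom_ext <;> simp [hx']
  · intro W hW n (x : M ⊞ M ⟶ W) hx
    have hx' : biprod.inl ≫ x = 0 := by
      have := congrArg (fun z => biprod.inr ≫ z) hx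
      simpa using this
    refine ⟨biprod.fst ≫ biprod.inr ≫ x, ?_⟩
    apply biprod.hom_ext' <;> simp [hx']
  · exact
      { hom := cokernel.desc _ biprod.snd (by simp)
        inv := biprod.inr ≫ cokernel.π _
        hom_inv_id := by
          have h0 : (biprod.inl : M ⟶ M ⊞ M) ≫
              cokernel.π ((biprod.snd : M ⊞ M ⟶ M) ≫ (biprod.inl : M ⟶ M ⊞ M)) = 0 := by
            rw [← cancel_epi (biprod.snd : M ⊞ M ⟶ M), ← Category.assoc, cokernel.condition,
              comp_zero]
          rw [← cancel_epi (cokernel.π _)]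
          apply biprod.hom_ext'
          · simp [h0]
          · simp
        inv_hom_id := by simp }

/-- splicing short exact sequences -/
theorem splice {𝒲 : Set C} (T X : ℤ → C) (i : ∀ n, T (n + 1) ⟶ X n) (p : ∀ n, X n ⟶ T n)
    (hX : ∀ n, X n ∈ 𝒲) (h : ∀ n, HSES 𝒲 (i n) (p n)) : T 0 ∈ GorClass 𝒲 := by
  have := fun n => (h n).mono
  have := fun n => (h n).epi
  refine ⟨X, fun n => p (n + 1) ≫ i n, ⟨hX, ?_, ?_, ?_, ?_⟩, ⟨?_⟩⟩
  · intro n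
    simp [reassoc_of% (h (n + 1)).w]
  · intro n
    rw [ShortComplex.exact_iff_exact_up_to_refinements]
    intro Y (x : Y ⟶ X (n + 1)) hx
    have hx' : x ≫ p (n + 1) = 0 := by
      rw [← cancel_mono (i n)]; simpa using hx
    obtain ⟨y, hy⟩ := (h (n + 1)).lift x hx'
    obtain ⟨Y', π, hπ, z, hz⟩ := surjective_up_to_refinements_of_epi (p (n + 1 + 1)) y
    exact ⟨Y', π, hπ, z, by dsimp; rw [← reassoc_of% hz, hy]⟩
  · intro W hW n x hx
    have hx' : x ≫ p (n + 1) = 0 := by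
      rw [← cancel_mono (i n)]; simpa using hx
    obtain ⟨y, hy⟩ := (h (n + 1)).lift x hx'
    obtain ⟨z, hz⟩ := (h (n + 1 + 1)).lif W hW y
    exact ⟨z, by rw [reassoc_of% hz, hy]⟩
  · intro W hW n x hx
    have hx' : i (n + 1) ≫ x = 0 := by
      rw [← cancel_epi (p (n + 1 + 1))]; simpa using hx
    obtain ⟨y, hy⟩ := (h (n + 1)).desc x hx'
    obtain ⟨z, hz⟩ := (h n).ext W hW y
    exact ⟨z, by rw [Category.assoc, hz, hy]⟩
  · refine cokernelEpiComp (p (0 + 1)) (i 0) ≪≫ ?_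
    exact (cokernelIsCokernel (i 0)).coconePointUniqueUpToIso
      ((h 0).shortExact.gIsCokernel)

theorem char_mem {𝒲 𝒯 : Set C}
    (hr : ∀ M ∈ 𝒯, ∃ (G M' : C) (f : M ⟶ G) (g : G ⟶ M'), G ∈ 𝒲 ∧ M' ∈ 𝒯 ∧ HSES 𝒲 f g)
    (hl : ∀ M ∈ 𝒯, ∃ (M' G : C) (f : M' ⟶ G) (g : G ⟶ M), G ∈ 𝒲 ∧ M' ∈ 𝒯 ∧ HSES 𝒲 f g) :
    𝒯 ⊆ GorClass 𝒲 := by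
  intro M hM
  have hr' : ∀ M : 𝒯, ∃ (M' : 𝒯) (G : C) (f : M.1 ⟶ G) (g : G ⟶ M'.1), G ∈ 𝒲 ∧ HSES 𝒲 f g := by
    rintro ⟨M, hM⟩
    obtain ⟨G, M', f, g, h₁, h₂, h₃⟩ := hr M hM
    exact ⟨⟨M', h₂⟩, G, f, g, h₁, h₃⟩
  have hl' : ∀ M : 𝒯, ∃ (M' : 𝒯) (G : C) (f : M'.1 ⟶ G) (g : G ⟶ M.1), G ∈ 𝒲 ∧ HSES 𝒲 f g := by
    rintro ⟨M, hM⟩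
    obtain ⟨M', G, f, g, h₁, h₂, h₃⟩ := hl M hM
    exact ⟨⟨M', h₂⟩, G, f, g, h₁, h₃⟩
  choose R hR using hr'
  choose L hL using hl'
  let T : ℤ → 𝒯 := fun n => match n with
    | Int.ofNat k => L^[k] ⟨M, hM⟩
    | Int.negSucc k => R^[k + 1] ⟨M, hM⟩
  have hT : ∀ n : ℤ, ∃ (G : C) (f : (T (n + 1)).1 ⟶ G) (g : G ⟶ (T n).1),
      G ∈ 𝒲 ∧ HSES 𝒲 f g := by
    intro n
    match n with
    | Int.ofNat k =>
      have e : T (Int.ofNat k + 1) = L (T (Int.ofNat k)) :=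
        Function.iterate_succ_apply' L k _
      rw [e]
      exact hL _
    | Int.negSucc k =>
      have e : T (Int.negSucc k) = R (T (Int.negSucc k + 1)) := by
        have e1 : T (Int.negSucc k) = R (R^[k] ⟨M, hM⟩) := Function.iterate_succ_apply' R k _
        rw [e1]
        congr 1
        cases k with
        | zero => rfl
        | succ k => rfl
      rw [e]
      exact hR _
  choose X i p hX h using hT
  exact splice (fun n => (T n).1) X i p hX h

section E

variable [HasExt.{w} C]

/-- the class of objects with vanishing first Ext groups from and to a given class -/
def Perp (𝒲 : Set C) : Set C := {M | ∀ V ∈ 𝒲, E1.{w} M V ∧ E1.{w} V M}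

theorem gor_perp {𝒲 𝒳 : Set C} (h : 𝒲 ⊆ 𝒳) (h' : 𝒳 ⊆ Perp.{w} 𝒲) :
    GorClass 𝒳 ⊆ Perp.{w} 𝒲 := by
  intro M hM V hV
  constructor
  · obtain ⟨M', G, f, g, hG, -, hs⟩ := gor_left hM
    exact E1.of_extend hs.toSES (h' hG V hV).1 (hs.ext V (h hV))
  · obtain ⟨G, M', f, g, hG, -, hs⟩ := gor_right hM
    exact E1.of_lift hs.toSES (h' hG V hV).2 (hs.lif V (h hV))

/-- the extension closure -/
inductive EC (𝒮 : Set C) : C → Prop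
  | base (M : C) (h : M ∈ 𝒮) : EC 𝒮 M
  | ext (A B D : C) (f : A ⟶ B) (g : B ⟶ D) (h : SES f g) (hA : EC 𝒮 A) (hD : EC 𝒮 D) : EC 𝒮 B

theorem ec_perp {𝒲 𝒮 : Set C} (h : 𝒮 ⊆ Perp.{w} 𝒲) {M : C} (hM : EC 𝒮 M) :
    M ∈ Perp.{w} 𝒲 := by
  induction hM with
  | base M hM => exact h hM
  | ext A B D f g hs _ _ hA hD =>
    exact fun V hV => ⟨E1.mid_left hs (hA V hV).1 (hD V hV).1,
      E1.mid_right hs (hA V hV).2 (hD V hV).2⟩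

theorem ec_gor {𝒲 : Set C} (hsum : SumClosed 𝒲) (hp : 𝒲 ⊆ Perp.{w} 𝒲) :
    {M | EC (GorClass 𝒲 ∪ GorClass (GorClass 𝒲)) M} ⊆ GorClass 𝒲 := by
  have h0 : 𝒲 ⊆ GorClass 𝒲 := le_gor hsum
  have h1 : GorClass 𝒲 ⊆ Perp.{w} 𝒲 := gor_perp subset_rfl hp
  have h2 : GorClass (GorClass 𝒲) ⊆ Perp.{w} 𝒲 := gor_perp h0 h1
  have h3 : ∀ M, EC (GorClass 𝒲 ∪ GorClass (GorClass 𝒲)) M → M ∈ Perp.{w} 𝒲 := fun M hM =>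
    ec_perp (Set.union_subset h1 h2) hM
  have hH : ∀ {A B D : C} {f : A ⟶ B} {g : B ⟶ D}, SES f g →
      A ∈ Perp.{w} 𝒲 → D ∈ Perp.{w} 𝒲 → HSES 𝒲 f g := fun hs hA hD =>
    { hs with
      ext := fun V hV φ => E1.extend hs (hD V hV).1 φ
      lif := fun V hV φ => E1.lift hs (hA V hV).2 φ }
  apply char_mem
  · intro M hM
    suffices H : ∃ (G M' : C) (f : M ⟶ G) (g : G ⟶ M'), G ∈ 𝒲 ∧
        EC (GorClass 𝒲 ∪ GorClass (GorClass 𝒲)) M' ∧ SES f g by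
      obtain ⟨G, M', f, g, hG, hM', hs⟩ := H
      exact ⟨G, M', f, g, hG, hM', hH hs (h3 _ hM) (h3 _ hM')⟩
    induction hM with
    | base M hM =>
      rcases hM with hM | hM
      · obtain ⟨G, M', f, g, hG, hM', hs⟩ := gor_right hM
        exact ⟨G, M', f, g, hG, .base _ (Or.inl hM'), hs.toSES⟩
      · obtain ⟨G, M', f, g, hG, hM', hs⟩ := gor_right hM
        obtain ⟨W, G', f', g', hW, hG', hs'⟩ := gor_right hG
        obtain ⟨N, r, u, v, hr, huv⟩ := comp_mono hs.toSES hs'.toSES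
        exact ⟨W, N, _, r, hW, .ext _ _ _ u v huv (.base _ (Or.inr hM'))
          (.base _ (Or.inl hG')), hr⟩
    | ext A B D f g hs hA hD ihA ihD =>
      obtain ⟨WA, A', i, p, hWA, hA', hsA⟩ := ihA
      obtain ⟨WD, D', j, q, hWD, hD', hsD⟩ := ihD
      obtain ⟨t, ht⟩ := E1.extend hs (h3 _ hD WA hWA).1 i
      obtain ⟨N, a, r, u, v, har, huv⟩ := horse_mono hs hsA hsD t ht
      exact ⟨_, N, a, r, hsum hWA hWD, .ext _ _ _ u v huv hA' hD', har⟩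
  · intro M hM
    suffices H : ∃ (M' G : C) (f : M' ⟶ G) (g : G ⟶ M), G ∈ 𝒲 ∧
        EC (GorClass 𝒲 ∪ GorClass (GorClass 𝒲)) M' ∧ SES f g by
      obtain ⟨M', G, f, g, hG, hM', hs⟩ := H
      exact ⟨M', G, f, g, hG, hM', hH hs (h3 _ hM') (h3 _ hM)⟩
    induction hM with
    | base M hM =>
      rcases hM with hM | hM
      · obtain ⟨M', G, f, g, hG, hM', hs⟩ := gor_left hM
        exact ⟨M', G, f, g, hG, .base _ (Or.inl hM'), hs.toSES⟩
      · obtain ⟨M', G, f, g, hG, hM', hs⟩ := gor_left hM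
        obtain ⟨G', W, f', g', hW, hG', hs'⟩ := gor_left hG
        obtain ⟨N, k, u, v, hk, huv⟩ := comp_epi hs'.toSES hs.toSES
        exact ⟨N, W, k, _, hW, .ext _ _ _ u v huv (.base _ (Or.inl hG'))
          (.base _ (Or.inr hM')), hk⟩
    | ext A B D f g hs hA hD ihA ihD =>
      obtain ⟨A', WA, i, p, hWA, hA', hsA⟩ := ihA
      obtain ⟨D', WD, j, q, hWD, hD', hsD⟩ := ihD
      obtain ⟨t, ht⟩ := E1.lift hs (h3 _ hA WD hWD).2 q
      obtain ⟨N, k, a, u, v, hka, huv⟩ := horse_epi hs hsA hsD t ht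
      exact ⟨N, _, k, a, hsum hWA hWD, .ext _ _ _ u v huv hA' hD', hka⟩

theorem ses_biprod (A B : C) : SES (biprod.inl : A ⟶ A ⊞ B) (biprod.snd : A ⊞ B ⟶ B) := by
  refine SES.of (by simp) inferInstance inferInstance ?_
  intro X x hx
  refine ⟨X, 𝟙 X, inferInstance, x ≫ biprod.fst, ?_⟩
  apply biprod.hom_ext <;> simp [hx]

theorem gor_gor {𝒲 : Set C} (hsum : SumClosed 𝒲) (hp : 𝒲 ⊆ Perp.{w} 𝒲) :
    GorClass (GorClass 𝒲) = GorClass 𝒲 := by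
  apply Set.Subset.antisymm
  · intro M hM
    exact ec_gor hsum hp (EC.base M (Or.inr hM))
  · apply le_gor
    intro A B hA hB
    exact ec_gor hsum hp (EC.ext _ _ _ _ _ (ses_biprod A B) (.base _ (Or.inl hA))
      (.base _ (Or.inl hB)))

end E

end GorAux

variable [EnoughProjectives C] [EnoughInjectives C] [HasExt.{w} C]

/-- Corollary 3.10: if `𝒲 ⊥ 𝒲`, then `G^n(𝒲) = G(𝒲)` for each `n ≥ 1`. -/
theorem stmt_15 (𝒲 : Set C) (h𝒲iso : IsoClosed 𝒲) (h𝒲sum : SumClosed 𝒲)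
    (hperp : ∀ W ∈ 𝒲, ∀ W' ∈ 𝒲, extPerp W W')
    (n : ℕ) (hn : 1 ≤ n) :
    GorIter 𝒲 n = GorClass 𝒲 := by
  have hp : 𝒲 ⊆ GorAux.Perp.{w} 𝒲 := fun W hW V hV =>
    ⟨fun x => (hperp W hW V hV 1 le_rfl).elim _ _, fun x => (hperp V hV W hW 1 le_rfl).elim _ _⟩
  induction n, hn using Nat.le_induction with
  | base => rfl
  | succ n hn ih =>
    show GorClass (GorIter 𝒲 n) = GorClass 𝒲
    rw [ih]
    exact GorAux.gor_gor h𝒲sum hp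
end
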